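/- arXiv:1603.03456 — 3 statements merged into one kernel-verified Lean document; each statement's English description precedes it below -/
import Mathlib

section
/- For every g ≥ 2, the genus-g surface group π₁(S_g) is LERF: for every finitely generated subgroup H ≤ π₁(S_g) and every element γ ∈ π₁(S_g) with γ ∉ H, there exists a subgroup K ≤ π₁(S_g) of finite index such that H ≤ K and γ ∉ K. -/
/-- The standard surface relator `[a₁,b₁]⋯[a_g,b_g]` in the free group on the `2g`
generators `aᵢ = (i, false)` and `bᵢ = (i, true)`. -/
def surfaceRelator (g : ℕ) : FreeGroup (Fin g × Bool) :=
  (List.ofFn (fun i : Fin g =>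
    FreeGroup.of (i, false) * FreeGroup.of (i, true) *
      (FreeGroup.of (i, false))⁻¹ * (FreeGroup.of (i, true))⁻¹)).prod

/-- The genus-`g` surface group
`π₁(S_g) = ⟨a₁, b₁, …, a_g, b_g ∣ [a₁,b₁]⋯[a_g,b_g]⟩`. -/
abbrev SurfaceGroup (g : ℕ) : Type :=
  PresentedGroup ({surfaceRelator g} : Set (FreeGroup (Fin g × Bool)))

/-- A set `X` of tiles of a right-angled tiled surface: `refl k` crosses the wall of type `k`,
walls of types `k` and `next k` cross, and `side` two-colours the tiles on each type of wall. -/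
structure TileSystem (ι X : Type*) where
  next : Equiv.Perm ι
  refl : ι → X → X
  side : ι → X → Bool
  refl_refl : ∀ k x, refl k (refl k x) = x
  refl_comm : ∀ k x, refl k (refl (next k) x) = refl (next k) (refl k x)
  side_refl : ∀ k x, side k (refl k x) = !side k x
  side_refl_next : ∀ k x, side k (refl (next k) x) = side k x
  side_next_refl : ∀ k x, side (next k) (refl k x) = side (next k) x

namespace TileSystem

open scoped Classical

variable {ι X : Type*} (T : TileSystem ι X)

/-- A function on darts (a tile together with a wall type) that descends to edges. -/
def EdgeSymm (f : X × ι → ZMod 2) : Prop := ∀ x k, f (T.refl k x, k) = f (x, k)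

/-- A function on corners that descends to squares. -/
def SquareSymm (c : X × ι → ZMod 2) : Prop :=
  ∀ x k, c (T.refl k x, k) = c (x, k) ∧ c (T.refl (T.next k) x, k) = c (x, k)

/-- The mod 2 cellular boundary from squares to edges. -/
def boundary : (X × ι → ZMod 2) →ₗ[ZMod 2] (X × ι → ZMod 2) where
  toFun c := fun d => c d + c (d.1, T.next.symm d.2)
  map_add' a b := by ext d; simp only [Pi.add_apply]; ring
  map_smul' r a := by ext d; simp [mul_add]

@[simp] lemma boundary_apply (c : X × ι → ZMod 2) (x : X) (k : ι) :
    T.boundary c (x, k) = c (x, k) + c (x, T.next.symm k) := rfl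

/-- Finitely supported square chains. -/
def squareChains : Submodule (ZMod 2) (X × ι → ZMod 2) where
  carrier := {c | T.SquareSymm c ∧ c.support.Finite}
  zero_mem' := ⟨fun _ _ => ⟨rfl, rfl⟩, by simp⟩
  add_mem' := by
    rintro a b ⟨ha, ha'⟩ ⟨hb, hb'⟩
    refine ⟨fun x k => ?_, (ha'.union hb').subset (Function.support_add a b)⟩
    simp [(ha x k).1, (ha x k).2, (hb x k).1, (hb x k).2]
  smul_mem' := by
    rintro r a ⟨ha, ha'⟩
    refine ⟨fun x k => ?_, ha'.subset (Function.support_const_smul_subset r a)⟩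
    simp [(ha x k).1, (ha x k).2]

/-- Boundaries of finitely supported square chains. -/
def boundaries : Submodule (ZMod 2) (X × ι → ZMod 2) := T.squareChains.map T.boundary

/-- Edge functions supported on `D`. -/
def edgeFunctions (D : Finset (X × ι)) : Submodule (ZMod 2) (X × ι → ZMod 2) where
  carrier := {f | T.EdgeSymm f ∧ ∀ d ∉ D, f d = 0}
  zero_mem' := ⟨fun _ _ => rfl, fun _ _ => rfl⟩
  add_mem' := by
    rintro a b ⟨ha, ha'⟩ ⟨hb, hb'⟩
    exact ⟨fun x k => by simp [ha x k, hb x k], fun d hd => by simp [ha' d hd, hb' d hd]⟩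
  smul_mem' := by
    rintro r a ⟨ha, ha'⟩
    exact ⟨fun x k => by simp [ha x k], fun d hd => by simp [ha' d hd]⟩

/-- Square functions supported on `C`. -/
def squareFunctions (C : Finset (X × ι)) : Submodule (ZMod 2) (X × ι → ZMod 2) where
  carrier := {f | T.SquareSymm f ∧ ∀ d ∉ C, f d = 0}
  zero_mem' := ⟨fun _ _ => ⟨rfl, rfl⟩, fun _ _ => rfl⟩
  add_mem' := by
    rintro a b ⟨ha, ha'⟩ ⟨hb, hb'⟩
    exact ⟨fun x k => by simp [(ha x k).1, (ha x k).2, (hb x k).1, (hb x k).2],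
      fun d hd => by simp [ha' d hd, hb' d hd]⟩
  smul_mem' := by
    rintro r a ⟨ha, ha'⟩
    exact ⟨fun x k => by simp [(ha x k).1, (ha x k).2], fun d hd => by simp [ha' d hd]⟩

/-- A finite set of darts closed under reversal, i.e. a finite set of edges. -/
def Reversible (D : Finset (X × ι)) : Prop := ∀ x k, (x, k) ∈ D → (T.refl k x, k) ∈ D

/-- The corners of the squares all of whose edges lie in `D`. -/
noncomputable def corners (D : Finset (X × ι)) : Finset (X × ι) :=
  D.filter fun d => (d.1, T.next d.2) ∈ D ∧ (T.refl d.2 d.1, T.next d.2) ∈ D ∧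
    (T.refl (T.next d.2) d.1, d.2) ∈ D

lemma mem_corners {D : Finset (X × ι)} {x : X} {k : ι} :
    (x, k) ∈ T.corners D ↔ (x, k) ∈ D ∧ (x, T.next k) ∈ D ∧ (T.refl k x, T.next k) ∈ D ∧
      (T.refl (T.next k) x, k) ∈ D := by
  simp [corners]

/-- A function on tiles is summed over the walls of a tile. -/
noncomputable def vertexSum [Fintype ι] :
    (X × ι → ZMod 2) →ₗ[ZMod 2] (X → ZMod 2) where
  toFun f := fun x => ∑ k, f (x, k)
  map_add' a b := by ext x; simp [Finset.sum_add_distrib]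
  map_smul' r a := by ext x; simp [Finset.mul_sum]

lemma refl_injective (k : ι) : Function.Injective (T.refl k) :=
  Function.LeftInverse.injective (T.refl_refl k)

variable {T}

lemma Reversible.mem_iff {D : Finset (X × ι)} (hD : T.Reversible D) {x : X} {k : ι} :
    (T.refl k x, k) ∈ D ↔ (x, k) ∈ D :=
  ⟨fun h => by simpa [T.refl_refl] using hD _ _ h, hD x k⟩

lemma Reversible.corners_refl {D : Finset (X × ι)} (hD : T.Reversible D) {x : X} {k : ι} :
    (T.refl k x, k) ∈ T.corners D ↔ (x, k) ∈ T.corners D := by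
  simp only [mem_corners, T.refl_refl, hD.mem_iff, ← T.refl_comm]
  tauto

lemma Reversible.corners_refl_next {D : Finset (X × ι)} (hD : T.Reversible D) {x : X} {k : ι} :
    (T.refl (T.next k) x, k) ∈ T.corners D ↔ (x, k) ∈ T.corners D := by
  simp only [mem_corners, T.refl_refl, hD.mem_iff, T.refl_comm]
  tauto

lemma card_le_two_mul {D : Finset (X × ι)} (hD : T.Reversible D) :
    D.card ≤ 2 * (D.filter fun d => T.side d.2 d.1 = false).card := by
  have h := Finset.card_filter_add_card_filter_not (s := D) (fun d => T.side d.2 d.1 = false)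
  have h2 : (D.filter fun d => ¬ T.side d.2 d.1 = false).card ≤
      (D.filter fun d => T.side d.2 d.1 = false).card := by
    refine Finset.card_le_card_of_injOn (fun d => (T.refl d.2 d.1, d.2)) ?_ ?_
    · rintro ⟨x, k⟩ hx
      simp only [Finset.coe_filter, Set.mem_ofPred_eq] at hx ⊢
      exact ⟨hD _ _ hx.1, by simpa [T.side_refl] using hx.2⟩
    · rintro ⟨x, k⟩ - ⟨y, l⟩ - h
      simp only [Prod.mk.injEq] at h
      obtain ⟨h, rfl⟩ := h
      have := congrArg (T.refl k) h
      simp only [T.refl_refl] at this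
      rw [this]
  omega

lemma four_mul_le_card {D : Finset (X × ι)} (hD : T.Reversible D) :
    4 * ((T.corners D).filter fun d => T.side d.2 d.1 = false ∧
      T.side (T.next d.2) d.1 = false).card ≤ (T.corners D).card := by
  set C := (T.corners D).filter fun d => T.side d.2 d.1 = false ∧
      T.side (T.next d.2) d.1 = false with hC
  let f : Bool × Bool → X × ι → X × ι := fun b d =>
    ((if b.1 then T.refl d.2 else id) ((if b.2 then T.refl (T.next d.2) else id) d.1), d.2)
  have : ((Finset.univ : Finset (Bool × Bool)) ×ˢ C).card ≤ (T.corners D).card := by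
    refine Finset.card_le_card_of_injOn (fun p => f p.1 p.2) ?_ ?_
    · rintro ⟨⟨b, b'⟩, x, k⟩ hx
      simp only [Finset.coe_product, Set.mem_prod, Finset.mem_coe, hC, Finset.mem_filter] at hx
      cases b <;> cases b' <;>
        simp [f, hD.corners_refl, hD.corners_refl_next, hx.2.1]
    · rintro ⟨⟨b, b'⟩, x, k⟩ hx ⟨⟨e, e'⟩, y, l⟩ hy h
      simp only [Finset.coe_product, Set.mem_prod, Finset.mem_coe, hC, Finset.mem_filter] at hx hy
      simp only [f, Prod.mk.injEq] at h
      obtain ⟨h, rfl⟩ := h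
      have h1 := congrArg (T.side k) h
      have h2 := congrArg (T.side (T.next k)) h
      have hb : b = e := by
        cases b <;> cases b' <;> cases e <;> cases e' <;>
          simp [T.side_refl, T.side_refl_next, hx.2.2, hy.2.2] at h1 ⊢
      have hb' : b' = e' := by
        cases b <;> cases b' <;> cases e <;> cases e' <;>
          simp [T.side_refl, T.side_next_refl, hx.2.2, hy.2.2] at h2 ⊢
      subst hb hb'
      have hxy : x = y := by
        cases b <;> cases b' <;>
          simpa [(T.refl_injective _).eq_iff] using h
      rw [hxy]
  simpa using this

lemma corners_subset (D : Finset (X × ι)) : T.corners D ⊆ D := Finset.filter_subset _ _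

lemma corners_mono {D D' : Finset (X × ι)} (h : D ⊆ D') : T.corners D ⊆ T.corners D' := by
  rintro ⟨x, k⟩ hx
  rw [mem_corners] at hx ⊢
  exact ⟨h hx.1, h hx.2.1, h hx.2.2.1, h hx.2.2.2⟩

variable (T) in
/-- Twice the number of edges minus four times the number of squares: the length of the boundary
of the subcomplex spanned by `D`. -/
noncomputable def perimeter (D : Finset (X × ι)) : ℕ := D.card - (T.corners D).card

lemma perimeter_add_card_corners (D : Finset (X × ι)) :
    T.perimeter D + (T.corners D).card = D.card :=
  Nat.sub_add_cancel (Finset.card_le_card (corners_subset D))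

lemma exists_squareFunctions_of_minimal {D : Finset (X × ι)} (hD : T.Reversible D)
    (hmin : ∀ D', T.Reversible D' → D ⊆ D' → T.perimeter D ≤ T.perimeter D')
    {c : X × ι → ZMod 2} (hc : c ∈ T.squareChains) (hcD : ∀ d ∉ D, T.boundary c d = 0) :
    ∃ c' ∈ T.squareFunctions (T.corners D), T.boundary c' = T.boundary c := by
  obtain ⟨hsymm, hfin⟩ := hc
  set S : Finset (X × ι) := hfin.toFinset.filter fun d => d ∉ T.corners D with hS
  have memS : ∀ d, d ∈ S ↔ c d ≠ 0 ∧ d ∉ T.corners D := fun d => by simp [hS]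
  let shift : X × ι ↪ X × ι := ((Equiv.refl X).prodCongr T.next).toEmbedding
  have memShift : ∀ x k, (x, k) ∈ S.map shift ↔ (x, T.next.symm k) ∈ S := by
    intro x k
    simp only [Finset.mem_map, shift]
    constructor
    · rintro ⟨⟨y, l⟩, hy, h⟩
      simp only [Equiv.coe_toEmbedding, Equiv.prodCongr_apply, Equiv.coe_refl, Prod.map_apply, id,
        Prod.mk.injEq] at h
      obtain ⟨rfl, rfl⟩ := h
      simpa using hy
    · intro h
      exact ⟨_, h, by simp⟩
  have memNext : ∀ x k, (x, k) ∈ S → (x, T.next k) ∈ S.map shift := by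
    intro x k h
    rw [memShift]; simpa using h
  have hS1 : ∀ x k, (x, k) ∈ S → (T.refl k x, k) ∈ S := by
    intro x k h
    rw [memS] at h ⊢
    rwa [(hsymm x k).1, hD.corners_refl]
  have hS2 : ∀ x k, (x, k) ∈ S → (T.refl (T.next k) x, k) ∈ S := by
    intro x k h
    rw [memS] at h ⊢
    rwa [(hsymm x k).2, hD.corners_refl_next]
  set D' := D ∪ (S ∪ S.map shift) with hD'
  have hrev : T.Reversible D' := by
    intro x k h
    simp only [hD', Finset.mem_union] at h ⊢
    rcases h with h | h | h
    · exact Or.inl (hD _ _ h)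
    · exact Or.inr (Or.inl (hS1 _ _ h))
    · refine Or.inr (Or.inr ?_)
      rw [memShift] at h ⊢
      simpa using hS2 _ _ h
  have hcorn : T.corners D ∪ S ⊆ T.corners D' := by
    refine Finset.union_subset (corners_mono Finset.subset_union_left) ?_
    rintro ⟨x, k⟩ h
    rw [mem_corners]
    simp only [hD', Finset.mem_union]
    exact ⟨.inr (.inl h), .inr (.inr (memNext _ _ h)), .inr (.inr (memNext _ _ (hS1 _ _ h))),
      .inr (.inl (hS2 _ _ h))⟩
  have hdisj : Disjoint (T.corners D) S :=
    Finset.disjoint_right.2 fun d hd => ((memS d).1 hd).2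
  set N := (S ∪ S.map shift) \ D with hN
  have hNboth : ∀ x k, (x, k) ∈ N → (x, k) ∈ S ∧ (x, k) ∈ S.map shift := by
    intro x k h
    rw [hN, Finset.mem_sdiff, Finset.mem_union, memShift] at h
    rw [memShift]
    obtain ⟨h, hnot⟩ := h
    have h0 := hcD _ hnot
    rw [boundary_apply] at h0
    have heq : c (x, k) = c (x, T.next.symm k) := CharTwo.add_eq_zero.1 h0
    have h1 : (x, k) ∉ T.corners D := fun h => hnot (corners_subset D h)
    have h2 : (x, T.next.symm k) ∉ T.corners D := fun h => hnot <| by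
      have := (T.mem_corners.1 h).2.1
      simpa using this
    simp only [memS, heq] at h ⊢
    tauto
  have hNS : N ⊆ S := fun ⟨x, k⟩ h => (hNboth x k h).1
  have hNS' : N ⊆ S.map shift := fun ⟨x, k⟩ h => (hNboth x k h).2
  have hcard : S.card ≤ N.card := by
    have h1 := hmin D' hrev Finset.subset_union_left
    have h2 := Finset.card_le_card hcorn
    rw [Finset.card_union_of_disjoint hdisj] at h2
    have h3 : D'.card = N.card + D.card := by
      rw [hD', ← Finset.union_sdiff_self_eq_union, add_comm,
        Finset.card_union_of_disjoint Finset.disjoint_sdiff]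
    have h4 := T.perimeter_add_card_corners D
    have h5 := T.perimeter_add_card_corners D'
    omega
  have e1 : N = S := Finset.eq_of_subset_of_card_le hNS hcard
  have e2 : N = S.map shift := Finset.eq_of_subset_of_card_le hNS' (by simpa using hcard)
  have hSS : ∀ x k, (x, k) ∈ S ↔ (x, T.next.symm k) ∈ S := by
    intro x k
    rw [← memShift, ← e2, e1]
  refine ⟨fun d => if d ∈ T.corners D then c d else 0, ⟨fun x k => ?_, fun d hd => if_neg hd⟩, ?_⟩
  · simp only [hD.corners_refl, hD.corners_refl_next, (hsymm x k).1, (hsymm x k).2, and_self]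
  · have key : ∀ d, (if d ∈ T.corners D then c d else 0) = c d + if d ∈ S then 1 else 0 := by
      intro d
      have h2 : ∀ a : ZMod 2, a = 0 ∨ a = 1 := by decide
      have hm := memS d
      rcases h2 (c d) with h | h <;> by_cases h' : d ∈ T.corners D <;> simp [h, h'] at hm <;>
        simp [h, h', hm]
      decide
    ext ⟨x, k⟩
    rw [boundary_apply, boundary_apply, key, key]
    simp only [hSS x k]
    have : ∀ a b e : ZMod 2, a + e + (b + e) = a + b := by decide
    exact this _ _ _

lemma five_mul_card_image_add_le
    (hnext : ∀ K : Finset ι, K.Nonempty → (∀ k ∈ K, T.next k ∈ K) → 5 ≤ K.card)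
    (D : Finset (X × ι)) :
    5 * (D.image Prod.fst).card + 4 * (T.corners D).card ≤ 5 * D.card := by
  have hD : D.card = ∑ x ∈ D.image Prod.fst, (D.filter fun d => d.1 = x).card :=
    Finset.card_eq_sum_card_fiberwise fun d hd => Finset.mem_image_of_mem _ hd
  have hC : (T.corners D).card =
      ∑ x ∈ D.image Prod.fst, ((T.corners D).filter fun d => d.1 = x).card :=
    Finset.card_eq_sum_card_fiberwise fun d hd =>
      Finset.mem_image_of_mem _ (corners_subset D hd)
  rw [hD, hC, Finset.card_eq_sum_ones, Finset.mul_sum, Finset.mul_sum, Finset.mul_sum,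
    ← Finset.sum_add_distrib]
  refine Finset.sum_le_sum fun x hx => ?_
  obtain ⟨⟨y, k₀⟩, hk₀, rfl⟩ := Finset.mem_image.1 hx
  have hsub : (T.corners D).filter (fun d => d.1 = y) ⊆ D.filter fun d => d.1 = y :=
    Finset.filter_subset_filter _ (corners_subset D)
  rcases (Finset.card_le_card hsub).lt_or_eq with h | h
  · dsimp only; omega
  · have heq := Finset.eq_of_subset_of_card_le hsub h.ge
    have h5 := hnext ((D.filter fun d => d.1 = y).image Prod.snd)
      ⟨k₀, Finset.mem_image.2 ⟨_, Finset.mem_filter.2 ⟨hk₀, rfl⟩, rfl⟩⟩ (by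
        intro k hk
        obtain ⟨⟨z, l⟩, hz, rfl⟩ := Finset.mem_image.1 hk
        have hz' := hz
        rw [← heq, Finset.mem_filter] at hz'
        obtain ⟨hz', hzy⟩ := hz'
        exact Finset.mem_image.2
          ⟨(z, T.next l), Finset.mem_filter.2 ⟨(T.mem_corners.1 hz').2.1, hzy⟩, rfl⟩)
    have := h5.trans Finset.card_image_le
    dsimp only; omega

lemma exists_edgeFunctions {D : Finset (X × ι)} (hD : T.Reversible D) :
    FiniteDimensional (ZMod 2) (T.edgeFunctions D) ∧
      D.card ≤ 2 * Module.finrank (ZMod 2) (T.edgeFunctions D) := by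
  set D₀ := D.filter fun d => T.side d.2 d.1 = false with hD₀
  have hfin : FiniteDimensional (ZMod 2) (T.edgeFunctions D) := by
    let φ : T.edgeFunctions D →ₗ[ZMod 2] (D → ZMod 2) :=
      (LinearMap.funLeft (ZMod 2) (ZMod 2) (Subtype.val : D → X × ι)) ∘ₗ
        (T.edgeFunctions D).subtype
    refine FiniteDimensional.of_injective φ ?_
    rw [injective_iff_map_eq_zero]
    rintro ⟨f, hf, hf'⟩ h
    ext d
    by_cases hd : d ∈ D
    · exact congrFun h ⟨d, hd⟩
    · exact hf' d hd
  refine ⟨hfin, (card_le_two_mul hD).trans (Nat.mul_le_mul_left 2 ?_)⟩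
  let rep : X × ι → X × ι := fun d => if T.side d.2 d.1 = false then d else (T.refl d.2 d.1, d.2)
  have hrep : ∀ x k, rep (T.refl k x, k) = rep (x, k) := by
    intro x k
    cases h : T.side k x <;> simp [rep, h, T.side_refl, T.refl_refl]
  let ψ₀ : (D₀ → ZMod 2) →ₗ[ZMod 2] (X × ι → ZMod 2) :=
    { toFun := fun f d => if h : rep d ∈ D₀ then f ⟨rep d, h⟩ else 0
      map_add' := fun a b => by ext d; by_cases h : rep d ∈ D₀ <;> simp [h]
      map_smul' := fun r a => by ext d; by_cases h : rep d ∈ D₀ <;> simp [h] }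
  have hψ₀ : ∀ f, ψ₀ f ∈ T.edgeFunctions D := by
    refine fun f => ⟨fun x k => ?_, ?_⟩
    · simp only [ψ₀, LinearMap.coe_mk, AddHom.coe_mk, hrep]
    · rintro ⟨x, k⟩ hd
      refine dif_neg fun h => hd ?_
      rw [hD₀, Finset.mem_filter] at h
      simp only [rep] at h
      split_ifs at h
      · exact h.1
      · exact hD.mem_iff.1 h.1
  have := LinearMap.finrank_le_finrank_of_injective (f := ψ₀.codRestrict _ hψ₀) (by
    rw [injective_iff_map_eq_zero]
    intro f hf
    ext ⟨d, hd⟩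
    have h1 : ψ₀ f d = 0 := congrFun (congrArg Subtype.val hf) d
    have h2 : rep d = d := if_pos (Finset.mem_filter.1 hd).2
    simpa [ψ₀, h2, hd] using h1)
  simpa using this

lemma finrank_squareFunctions_le {D : Finset (X × ι)} (hD : T.Reversible D) :
    FiniteDimensional (ZMod 2) (T.squareFunctions (T.corners D)) ∧
      4 * Module.finrank (ZMod 2) (T.squareFunctions (T.corners D)) ≤ (T.corners D).card := by
  set C₀ := (T.corners D).filter fun d => T.side d.2 d.1 = false ∧
      T.side (T.next d.2) d.1 = false with hC₀
  let φ : T.squareFunctions (T.corners D) →ₗ[ZMod 2] (C₀ → ZMod 2) :=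
    (LinearMap.funLeft (ZMod 2) (ZMod 2) (Subtype.val : C₀ → X × ι)) ∘ₗ
      (T.squareFunctions (T.corners D)).subtype
  have hφ : Function.Injective φ := by
    rw [injective_iff_map_eq_zero]
    rintro ⟨f, hf, hf'⟩ h
    have h0 : ∀ x k, T.side k x = false → T.side (T.next k) x = false → f (x, k) = 0 := by
      intro x k h1 h2
      by_cases hd : (x, k) ∈ T.corners D
      · exact congrFun h ⟨(x, k), Finset.mem_filter.2 ⟨hd, h1, h2⟩⟩
      · exact hf' _ hd
    have h1 : ∀ x k, T.side k x = false → f (x, k) = 0 := by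
      intro x k h1
      cases h2 : T.side (T.next k) x
      · exact h0 x k h1 h2
      · rw [← (hf x k).2]
        exact h0 _ k (by rw [T.side_refl_next, h1]) (by rw [T.side_refl, h2]; rfl)
    ext ⟨x, k⟩
    cases h2 : T.side k x
    · exact h1 x k h2
    · change f (x, k) = 0
      rw [← (hf x k).1]
      exact h1 _ k (by rw [T.side_refl, h2]; rfl)
  refine ⟨FiniteDimensional.of_injective φ hφ,
    (Nat.mul_le_mul_left 4 ?_).trans (four_mul_le_card hD)⟩
  simpa using LinearMap.finrank_le_finrank_of_injective hφ

lemma two_mul_card_le [Fintype ι] {D : Finset (X × ι)} (hD : T.Reversible D)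
    (hmin : ∀ D', T.Reversible D' → D ⊆ D' → T.perimeter D ≤ T.perimeter D')
    (Θ : Submodule (ZMod 2) ((X × ι → ZMod 2) ⧸ T.boundaries)) [FiniteDimensional (ZMod 2) Θ]
    (hΘ : ∀ f : X × ι → ZMod 2, T.EdgeSymm f → f.support.Finite → vertexSum f = 0 →
      T.boundaries.mkQ f ∈ Θ) :
    2 * D.card ≤ 4 * (D.image Prod.fst).card + (T.corners D).card +
      4 * Module.finrank (ZMod 2) Θ := by
  obtain ⟨hf1, h1⟩ := exists_edgeFunctions hD
  obtain ⟨hf2, h2⟩ := finrank_squareFunctions_le hD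
  set V := D.image Prod.fst with hV
  let σ : T.edgeFunctions D →ₗ[ZMod 2] (V → ZMod 2) :=
    (LinearMap.funLeft (ZMod 2) (ZMod 2) (Subtype.val : V → X)) ∘ₗ vertexSum ∘ₗ
      (T.edgeFunctions D).subtype
  have hσ : ∀ f, σ f = 0 → vertexSum f.1 = 0 := by
    intro f hf
    ext x
    by_cases hx : x ∈ V
    · exact congrFun hf ⟨x, hx⟩
    · refine Finset.sum_eq_zero fun k _ => f.2.2 _ fun h => hx ?_
      exact Finset.mem_image_of_mem Prod.fst h
  have h3 := LinearMap.finrank_range_add_finrank_ker σ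
  have h4 : Module.finrank (ZMod 2) (LinearMap.range σ) ≤ V.card := by
    simpa using Submodule.finrank_le (LinearMap.range σ)
  let q : LinearMap.ker σ →ₗ[ZMod 2] ((X × ι → ZMod 2) ⧸ T.boundaries) :=
    T.boundaries.mkQ ∘ₗ (T.edgeFunctions D).subtype ∘ₗ (LinearMap.ker σ).subtype
  have h5 := LinearMap.finrank_range_add_finrank_ker q
  have h6 : Module.finrank (ZMod 2) (LinearMap.range q) ≤ Module.finrank (ZMod 2) Θ := by
    refine Submodule.finrank_mono ?_
    rintro _ ⟨f, rfl⟩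
    exact hΘ f.1.1 f.1.2.1
      (D.finite_toSet.subset fun d hd => by_contra fun h => hd (f.1.2.2 d h)) (hσ _ f.2)
  have h7 : Module.finrank (ZMod 2) (LinearMap.ker q) ≤
      Module.finrank (ZMod 2) (T.squareFunctions (T.corners D)) := by
    let incl : LinearMap.ker q →ₗ[ZMod 2] (X × ι → ZMod 2) :=
      (T.edgeFunctions D).subtype ∘ₗ (LinearMap.ker σ).subtype ∘ₗ (LinearMap.ker q).subtype
    have hincl : Function.Injective incl :=
      Subtype.val_injective.comp (Subtype.val_injective.comp Subtype.val_injective)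
    have hrange : LinearMap.range incl ≤ (T.squareFunctions (T.corners D)).map T.boundary := by
      rintro _ ⟨f, rfl⟩
      have hf : T.boundaries.mkQ (incl f) = 0 := f.2
      rw [Submodule.mkQ_apply, Submodule.Quotient.mk_eq_zero] at hf
      obtain ⟨c, hc, hcf⟩ := hf
      obtain ⟨c', hc', hcc⟩ := exists_squareFunctions_of_minimal hD hmin hc
        (fun d hd => by rw [hcf]; exact f.1.1.2.2 d hd)
      exact ⟨c', hc', hcc.trans hcf⟩
    calc _ = Module.finrank (ZMod 2) (LinearMap.range incl) :=
          (LinearMap.finrank_range_of_inj hincl).symm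
      _ ≤ _ := Submodule.finrank_mono hrange
      _ ≤ _ := Submodule.finrank_map_le _ _
  omega

lemma exists_perimeter_le {D : Finset (X × ι)} (hD : T.Reversible D) {x : X} {k : ι}
    (h1 : (x, k) ∈ D) (h2 : (x, T.next k) ∈ D) (h3 : (x, k) ∉ T.corners D) :
    ∃ D', T.Reversible D' ∧ D ⊂ D' ∧ T.perimeter D' ≤ T.perimeter D := by
  set N : Finset (X × ι) := {(T.refl (T.next k) x, k), (T.refl k (T.refl (T.next k) x), k),
    (T.refl k x, T.next k), (T.refl (T.next k) (T.refl k x), T.next k)} with hN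
  set Q : Finset (X × ι) := {(x, k), (T.refl k x, k), (T.refl (T.next k) x, k),
    (T.refl k (T.refl (T.next k) x), k)} with hQ
  have hrev : T.Reversible (D ∪ N) := by
    intro y l h
    rw [Finset.mem_union] at h ⊢
    refine h.imp (hD y l) fun h => ?_
    simp only [hN, Finset.mem_insert, Finset.mem_singleton, Prod.mk.injEq] at h ⊢
    rcases h with ⟨rfl, rfl⟩ | ⟨rfl, rfl⟩ | ⟨rfl, rfl⟩ | ⟨rfl, rfl⟩ <;> simp [T.refl_refl]
  have hx : (x, k) ∈ T.corners (D ∪ N) := by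
    rw [mem_corners]
    simp [h1, h2, hN]
  have hQsub : Q ⊆ T.corners (D ∪ N) := by
    intro d hd
    simp only [hQ, Finset.mem_insert, Finset.mem_singleton] at hd
    rcases hd with rfl | rfl | rfl | rfl <;>
      simpa only [hrev.corners_refl, hrev.corners_refl_next] using hx
  have hdisj : Disjoint (T.corners D) Q := by
    rw [Finset.disjoint_right]
    intro d hd
    simp only [hQ, Finset.mem_insert, Finset.mem_singleton] at hd
    rcases hd with rfl | rfl | rfl | rfl <;>
      simpa only [hD.corners_refl, hD.corners_refl_next] using h3
  have hQcard : Q.card = 4 := by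
    have hk : ∀ y, T.refl k y ≠ y := fun y h => by
      simpa [T.side_refl] using congrArg (T.side k) h
    have hk' : ∀ y, T.refl (T.next k) y ≠ y := fun y h => by
      simpa [T.side_refl] using congrArg (T.side (T.next k)) h
    have hkk : T.refl k x ≠ T.refl (T.next k) x := fun h => by
      simpa [T.side_refl, T.side_refl_next] using congrArg (T.side k) h
    have hkk' : x ≠ T.refl k (T.refl (T.next k) x) := fun h => by
      simpa [T.side_refl, T.side_refl_next] using congrArg (T.side k) h
    rw [hQ, Finset.card_insert_of_notMem, Finset.card_insert_of_notMem,
      Finset.card_insert_of_notMem, Finset.card_singleton]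
    · simpa using (hk _).symm
    · simp [hkk, (T.refl_injective _).eq_iff, (hk' x).symm]
    · simp [(hk _).symm, (hk' _).symm, hkk']
  have hNcard : N.card ≤ 4 := Finset.card_le_four
  refine ⟨D ∪ N, hrev, Finset.ssubset_iff_subset_ne.2 ⟨Finset.subset_union_left, fun h => ?_⟩, ?_⟩
  · rw [← h] at hx
    exact h3 hx
  · have e1 := Finset.card_le_card
      (Finset.union_subset (corners_mono (T := T) (Finset.subset_union_left (s₂ := N))) hQsub)
    rw [Finset.card_union_of_disjoint hdisj] at e1
    have e2 := Finset.card_union_le D N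
    have e3 := T.perimeter_add_card_corners D
    have e4 := T.perimeter_add_card_corners (D ∪ N)
    omega

/-- In a tiling with finite-dimensional first homology whose vertices have valence at least five,
every finite set of edges lies in a finite set of edges that is locally convex. -/
theorem exists_locallyConvex [Fintype ι]
    (hnext : ∀ K : Finset ι, K.Nonempty → (∀ k ∈ K, T.next k ∈ K) → 5 ≤ K.card)
    (Θ : Submodule (ZMod 2) ((X × ι → ZMod 2) ⧸ T.boundaries)) [FiniteDimensional (ZMod 2) Θ]
    (hΘ : ∀ f : X × ι → ZMod 2, T.EdgeSymm f → f.support.Finite → vertexSum f = 0 →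
      T.boundaries.mkQ f ∈ Θ)
    {D₀ : Finset (X × ι)} (hD₀ : T.Reversible D₀) :
    ∃ D, T.Reversible D ∧ D₀ ⊆ D ∧
      ∀ x k, (x, k) ∈ D → (x, T.next k) ∈ D → (x, k) ∈ T.corners D := by
  have hex : ∃ p, ∃ D, T.Reversible D ∧ D₀ ⊆ D ∧ T.perimeter D = p := ⟨_, D₀, hD₀, subset_rfl, rfl⟩
  set p := Nat.find hex
  have hp : ∀ D, T.Reversible D → D₀ ⊆ D → p ≤ T.perimeter D :=
    fun D h h' => Nat.find_min' hex ⟨D, h, h', rfl⟩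
  set S : Set ℕ := {n | ∃ D, (T.Reversible D ∧ D₀ ⊆ D ∧ T.perimeter D = p) ∧ D.card = n}
  have hS : BddAbove S := by
    refine ⟨20 * Module.finrank (ZMod 2) Θ + 12 * p, ?_⟩
    rintro _ ⟨D, ⟨hD, hD', hDp⟩, rfl⟩
    have e1 := five_mul_card_image_add_le hnext D
    have e2 := two_mul_card_le hD (fun D' h h' => hDp ▸ hp D' h (hD'.trans h')) Θ hΘ
    have e3 := T.perimeter_add_card_corners D
    omega
  obtain ⟨D, ⟨hD, hD', hDp⟩, hcard⟩ : sSup S ∈ S :=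
    Nat.sSup_mem (let ⟨D, h⟩ := Nat.find_spec hex; ⟨_, D, h, rfl⟩) hS
  refine ⟨D, hD, hD', fun x k h1 h2 => by_contra fun h3 => ?_⟩
  obtain ⟨E, hE, hDE, hle⟩ := exists_perimeter_le hD h1 h2 h3
  have hE' := hD'.trans hDE.subset
  have := le_csSup hS ⟨E, ⟨hE, hE', le_antisymm (hle.trans hDp.le) (hp E hE hE')⟩, rfl⟩
  have := Finset.card_lt_card hDE
  omega

variable (T) in
/-- The class of an edge among edge functions modulo boundaries. -/
noncomputable def edgeClass (x : X) (k : ι) : (X × ι → ZMod 2) ⧸ T.boundaries :=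
  T.boundaries.mkQ (Pi.single (x, k) 1 + Pi.single (T.refl k x, k) 1)

lemma edgeClass_refl (x : X) (k : ι) : T.edgeClass (T.refl k x) k = T.edgeClass x k := by
  rw [edgeClass, edgeClass, T.refl_refl, add_comm]

lemma boundary_single (x : X) (k : ι) :
    T.boundary (Pi.single (x, k) 1) = Pi.single (x, k) 1 + Pi.single (x, T.next k) 1 := by
  ext ⟨y, l⟩
  simp [Pi.single_apply, Equiv.symm_apply_eq]

lemma single_refl (a y : X) (k l : ι) :
    (Pi.single (a, k) 1 : X × ι → ZMod 2) (T.refl l y, l) =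
      (Pi.single (T.refl k a, k) 1 : X × ι → ZMod 2) (y, l) := by
  simp only [Pi.single_apply, Prod.mk.injEq]
  congr 1
  refine propext ⟨?_, ?_⟩ <;> rintro ⟨rfl, rfl⟩ <;> simp [T.refl_refl]

lemma single_refl_next (a y : X) (k l : ι) :
    (Pi.single (a, k) 1 : X × ι → ZMod 2) (T.refl (T.next l) y, l) =
      (Pi.single (T.refl (T.next k) a, k) 1 : X × ι → ZMod 2) (y, l) := by
  simp only [Pi.single_apply, Prod.mk.injEq]
  congr 1
  refine propext ⟨?_, ?_⟩ <;> rintro ⟨rfl, rfl⟩ <;> simp [T.refl_refl]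

lemma edgeClass_square (x : X) (k : ι) :
    T.edgeClass x k + T.edgeClass (T.refl (T.next k) x) k =
      T.edgeClass x (T.next k) + T.edgeClass (T.refl k x) (T.next k) := by
  rw [← sub_eq_zero, sub_eq_add_neg, ZModModule.neg_eq_self]
  simp only [edgeClass, ← map_add]
  rw [Submodule.mkQ_apply, Submodule.Quotient.mk_eq_zero]
  refine ⟨Pi.single (x, k) 1 + Pi.single (T.refl k x, k) 1 + Pi.single (T.refl (T.next k) x, k) 1
    + Pi.single (T.refl k (T.refl (T.next k) x), k) 1, ⟨fun y l => ?_, ?_⟩, ?_⟩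
  · simp only [Pi.add_apply, single_refl, single_refl_next, T.refl_refl, ← T.refl_comm]
    constructor <;> ring
  · have h : ∀ d : X × ι, (Function.support (Pi.single d (1 : ZMod 2))).Finite :=
      fun d => (Set.finite_singleton d).subset (Pi.support_single_subset)
    refine Set.Finite.subset ((((h _).union (h _)).union (h _)).union (h _))
      ((Function.support_add _ _).trans (Set.union_subset_union_left _
        ((Function.support_add _ _).trans (Set.union_subset_union_left _
          (Function.support_add _ _)))))
  · simp only [map_add, boundary_single, T.refl_comm]
    abel

/-- A cycle is a combination of the loops obtained by joining its edges to a base point. -/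
lemma mkQ_mem_of_potential [Fintype ι]
    (Θ : Submodule (ZMod 2) ((X × ι → ZMod 2) ⧸ T.boundaries))
    (τ : X → (X × ι → ZMod 2) ⧸ T.boundaries)
    (hτ : ∀ x k, T.edgeClass x k + (τ x + τ (T.refl k x)) ∈ Θ)
    {f : X × ι → ZMod 2} (hf : T.EdgeSymm f) (hfin : f.support.Finite) (hsum : vertexSum f = 0) :
    T.boundaries.mkQ f ∈ Θ := by
  set D := hfin.toFinset with hD
  have memD : ∀ d, d ∈ D ↔ f d ≠ 0 := fun d => by simp [hD]
  set D₀ := D.filter fun d => T.side d.2 d.1 = false with hD₀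
  set D₁ := D.filter fun d => ¬ T.side d.2 d.1 = false with hD₁
  have hbij : ∀ {M : Type _} [AddCommMonoid M] (F : X × ι → M),
      ∑ d ∈ D₁, F d = ∑ d ∈ D₀, F (T.refl d.2 d.1, d.2) := by
    intro M _ F
    refine Finset.sum_nbij' (fun d => (T.refl d.2 d.1, d.2)) (fun d => (T.refl d.2 d.1, d.2))
      ?_ ?_ ?_ ?_ ?_
    · rintro ⟨x, k⟩ h
      simp only [hD₀, hD₁, Finset.mem_filter, memD, hf x k, T.side_refl] at h ⊢
      exact ⟨h.1, by simpa using h.2⟩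
    · rintro ⟨x, k⟩ h
      simp only [hD₀, hD₁, Finset.mem_filter, memD, hf x k, T.side_refl] at h ⊢
      exact ⟨h.1, by simpa using h.2⟩
    · rintro ⟨x, k⟩ -; simp [T.refl_refl]
    · rintro ⟨x, k⟩ -; simp [T.refl_refl]
    · rintro ⟨x, k⟩ -; simp [T.refl_refl]
  have hsplit : ∀ {M : Type _} [AddCommMonoid M] (F : X × ι → M),
      ∑ d ∈ D, F d = ∑ d ∈ D₀, (F d + F (T.refl d.2 d.1, d.2)) := by
    intro M _ F
    rw [Finset.sum_add_distrib, ← hbij, hD₀, hD₁, Finset.sum_filter_add_sum_filter_not]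
  have hf_eq : f = ∑ d ∈ D₀, f d • (Pi.single d 1 + Pi.single (T.refl d.2 d.1, d.2) 1) := by
    calc f = ∑ d ∈ D, f d • Pi.single d (1 : ZMod 2) := by
          ext e
          by_cases he : f e = 0 <;> simp [Finset.sum_apply, Pi.single_apply, memD, he]
      _ = _ := by
          rw [hsplit]
          refine Finset.sum_congr rfl fun d _ => ?_
          rw [hf d.1 d.2, smul_add]
  have hzero : ∑ d ∈ D₀, f d • (τ d.1 + τ (T.refl d.2 d.1)) = 0 := by
    have h1 : ∑ d ∈ D, f d • τ d.1 = 0 := by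
      have hsub : D ⊆ (D.image Prod.fst) ×ˢ (Finset.univ : Finset ι) := fun d hd =>
        Finset.mem_product.2 ⟨Finset.mem_image_of_mem _ hd, Finset.mem_univ _⟩
      rw [Finset.sum_subset hsub fun d _ hd => by
        rw [memD, not_not] at hd; rw [hd, zero_smul], Finset.sum_product]
      refine Finset.sum_eq_zero fun x _ => ?_
      dsimp only
      rw [← Finset.sum_smul, show ∑ k, f (x, k) = 0 from congrFun hsum x, zero_smul]
    rw [← h1, hsplit]
    refine Finset.sum_congr rfl fun d _ => ?_
    rw [hf d.1 d.2, smul_add]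
  have hmk : T.boundaries.mkQ f =
      ∑ d ∈ D₀, f d • (T.edgeClass d.1 d.2 + (τ d.1 + τ (T.refl d.2 d.1))) := by
    simp only [smul_add _ (T.edgeClass _ _), Finset.sum_add_distrib]
    rw [hzero, add_zero]
    conv_lhs => rw [hf_eq]
    rw [map_sum]
    rfl
  rw [hmk]
  exact Submodule.sum_mem _ fun d _ => Submodule.smul_mem _ _ (hτ _ _)

end TileSystem

/-- The group generated by reflections indexed by `ι`, consecutive ones commuting. -/
abbrev ReflectionGroup {ι : Type*} (next : Equiv.Perm ι) : Type _ :=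
  PresentedGroup (Set.range (fun k : ι => FreeGroup.of k * FreeGroup.of k) ∪
    Set.range (fun k : ι => FreeGroup.of k * FreeGroup.of (next k) *
      (FreeGroup.of (next k) * FreeGroup.of k)⁻¹))

namespace ReflectionGroup

variable {ι : Type*} {next : Equiv.Perm ι} {Γ : Type*} [Group Γ]

variable (next) in
/-- The generating reflections. -/
def gen (k : ι) : ReflectionGroup next := PresentedGroup.of k

lemma gen_mul_self (k : ι) : gen next k * gen next k = 1 :=
  PresentedGroup.one_of_mem (Or.inl ⟨k, rfl⟩)

lemma gen_comm (k : ι) : gen next k * gen next (next k) = gen next (next k) * gen next k :=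
  PresentedGroup.mk_eq_mk_of_mul_inv_mem (Or.inr ⟨k, rfl⟩)

/-- The universal property of the reflection group. -/
def lift (s : ι → Γ) (h1 : ∀ k, s k * s k = 1) (h2 : ∀ k, s k * s (next k) = s (next k) * s k) :
    ReflectionGroup next →* Γ :=
  PresentedGroup.toGroup (f := s) (by
    rintro _ (⟨k, rfl⟩ | ⟨k, rfl⟩)
    · simpa using h1 k
    · rw [map_mul, map_inv, mul_inv_eq_one]
      simpa using h2 k)

@[simp] lemma lift_gen (s : ι → Γ) (h1 : ∀ k, s k * s k = 1)
    (h2 : ∀ k, s k * s (next k) = s (next k) * s k) (k : ι) : lift s h1 h2 (gen next k) = s k :=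
  PresentedGroup.toGroup.of _

lemma induction {P : ReflectionGroup next → Prop} (w : ReflectionGroup next)
    (one : P 1) (gen : ∀ k, P (gen next k)) (mul : ∀ a b, P a → P b → P (a * b))
    (inv : ∀ a, P a → P a⁻¹) : P w := by
  have hw : w ∈ Subgroup.closure (Set.range (PresentedGroup.of : ι → ReflectionGroup next)) := by
    rw [PresentedGroup.closure_range_of]; trivial
  induction hw using Subgroup.closure_induction with
  | mem x hx => obtain ⟨k, rfl⟩ := hx; exact gen k
  | one => exact one
  | mul x y _ _ hx hy => exact mul x y hx hy
  | inv x _ hx => exact inv x hx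

/-- Counts modulo 2 the reflections of each of the two colours. -/
def parity (color : ι → Bool) : ReflectionGroup next →* (Bool → Multiplicative (ZMod 2)) :=
  lift (fun k => Pi.mulSingle (color k) (Multiplicative.ofAdd 1))
    (fun k => by rw [← Pi.mulSingle_mul]; exact Pi.mulSingle_one _) (fun k => mul_comm _ _)

lemma parity_gen (color : ι → Bool) (k : ι) :
    parity color (gen next k) = Pi.mulSingle (color k) (Multiplicative.ofAdd 1) :=
  lift_gen _ _ _ _

variable {color : ι → Bool} {H : Subgroup (ReflectionGroup next)}

lemma parity_out_smul (hH : H ≤ (parity color).ker) (w : ReflectionGroup next)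
    (x : ReflectionGroup next ⧸ H) :
    parity color (w • x).out = parity color w * parity color x.out := by
  have h : (w • x) = ((w * x.out : ReflectionGroup next) : ReflectionGroup next ⧸ H) := by
    conv_lhs => rw [← QuotientGroup.out_eq' x]
    rfl
  obtain ⟨k, hk⟩ := QuotientGroup.mk_out_eq_mul H (w * x.out)
  rw [h, hk, map_mul, map_mul, MonoidHom.mem_ker.1 (hH k.2), mul_one]

/-- The tiled surface whose tiles are the cosets of a parity-preserving subgroup. -/
noncomputable abbrev tiling (hcolor : ∀ k, color (next k) = !color k)
    (hH : H ≤ (parity color).ker) : TileSystem ι (ReflectionGroup next ⧸ H) where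
  next := next
  refl k x := gen next k • x
  side k x := decide (parity color x.out (color k) = 1)
  refl_refl k x := by rw [smul_smul, gen_mul_self, one_smul]
  refl_comm k x := by rw [smul_smul, gen_comm, ← smul_smul]
  side_refl k x := by
    rw [parity_out_smul hH, parity_gen, Pi.mul_apply, Pi.mulSingle_eq_same]
    generalize parity color x.out (color k) = c
    revert c
    decide
  side_refl_next k x := by
    rw [parity_out_smul hH, parity_gen, Pi.mul_apply, Pi.mulSingle_eq_of_ne, one_mul]
    simp [hcolor]
  side_next_refl k x := by
    rw [parity_out_smul hH, parity_gen, Pi.mul_apply, Pi.mulSingle_eq_of_ne, one_mul]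
    simp [hcolor]

end ReflectionGroup

namespace TileSystem

open ReflectionGroup
open scoped Classical

variable {ι X : Type*} {T : TileSystem ι X}

/-- Crossing a wall of type `k` while recording the class of the edge crossed. -/
noncomputable def coverRefl (k : ι) :
    Equiv.Perm (X × ((X × ι → ZMod 2) ⧸ T.boundaries)) :=
  Function.Involutive.toPerm (fun p => (T.refl k p.1, T.edgeClass p.1 k + p.2)) (by
    rintro ⟨x, m⟩
    simp only [T.refl_refl, edgeClass_refl, ← add_assoc, ZModModule.add_self, zero_add])

variable (T) in
/-- The action of the reflection group on the homology cover. -/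
noncomputable def coverAction : ReflectionGroup T.next →*
    Equiv.Perm (X × ((X × ι → ZMod 2) ⧸ T.boundaries)) :=
  lift (coverRefl (T := T))
    (fun k => Equiv.ext fun p => Function.Involutive.toPerm_involutive _ p)
    (fun k => Equiv.ext fun ⟨x, m⟩ => by
      have h := T.edgeClass_square x k
      refine Prod.ext (T.refl_comm k x) ?_
      change T.edgeClass (T.refl (T.next k) x) k + (T.edgeClass x (T.next k) + m) =
        T.edgeClass (T.refl k x) (T.next k) + (T.edgeClass x k + m)
      rw [← add_assoc, ← add_assoc, add_left_inj, ← sub_eq_zero]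
      rw [← sub_eq_zero] at h
      simp only [sub_eq_add_neg, ZModModule.neg_eq_self] at h ⊢
      rw [← h]
      abel)

/-- Redirect the reflections so that only the walls in `D` are crossed. -/
noncomputable def foldRefl {D : Finset (X × ι)} (hD : T.Reversible D) (k : ι) : Equiv.Perm X :=
  Function.Involutive.toPerm (fun x => if (x, k) ∈ D then T.refl k x else x) (fun x => by
    by_cases h : (x, k) ∈ D <;> simp [h, hD.mem_iff, T.refl_refl])

lemma foldRefl_apply {D : Finset (X × ι)} (hD : T.Reversible D) (k : ι) (x : X) :
    foldRefl hD k x = if (x, k) ∈ D then T.refl k x else x := rfl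

/-- The action obtained by reflecting in the walls bounding a locally convex set of edges. -/
noncomputable def foldAction {D : Finset (X × ι)} (hD : T.Reversible D)
    (hconv : ∀ x k, (x, k) ∈ D → (x, T.next k) ∈ D → (x, k) ∈ T.corners D) :
    ReflectionGroup T.next →* Equiv.Perm X :=
  lift (foldRefl hD) (fun k => Equiv.ext fun p => Function.Involutive.toPerm_involutive _ p)
    (fun k => Equiv.ext fun x => by
      simp only [Equiv.Perm.mul_apply, foldRefl_apply]
      by_cases h1 : (x, k) ∈ D <;> by_cases h2 : (x, T.next k) ∈ D
      · obtain ⟨-, -, h3, h4⟩ := T.mem_corners.1 (hconv x k h1 h2)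
        simp [h1, h2, h3, h4, T.refl_comm]
      · have h3 : (T.refl k x, T.next k) ∉ D := fun h3 => h2 <| by
          have := (T.mem_corners.1 (hconv _ _ (hD _ _ h1) h3)).2.2.1
          rwa [T.refl_refl] at this
        simp [h1, h2, h3]
      · have h3 : (T.refl (T.next k) x, k) ∉ D := fun h3 => h1 <| by
          have := (T.mem_corners.1 (hconv _ _ h3 (hD _ _ h2))).2.2.2
          rwa [T.refl_refl] at this
        simp [h1, h2, h3]
      · simp [h1, h2])

variable (T) in
/-- The homology class swept out by the path which a word traces from a tile. -/
noncomputable def cocycle (w : ReflectionGroup T.next) (x : X) :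
    (X × ι → ZMod 2) ⧸ T.boundaries :=
  (T.coverAction w (x, 0)).2

lemma cocycle_gen (k : ι) (x : X) : T.cocycle (gen T.next k) x = T.edgeClass x k := by
  rw [cocycle, coverAction, lift_gen]
  exact add_zero _

lemma cocycle_one (x : X) : T.cocycle 1 x = 0 := by simp [cocycle]

lemma foldAction_mem {D : Finset (X × ι)} (hD : T.Reversible D)
    (hconv : ∀ x k, (x, k) ∈ D → (x, T.next k) ∈ D → (x, k) ∈ T.corners D)
    (w : ReflectionGroup T.next) (x₀ : X) :
    foldAction hD hconv w x₀ ∈ insert x₀ (D.image Prod.fst) := by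
  have key : ∀ x, foldAction hD hconv w x = x ∨
      (x ∈ D.image Prod.fst ∧ foldAction hD hconv w x ∈ D.image Prod.fst) := by
    induction w using ReflectionGroup.induction with
    | one => simp
    | gen k =>
      intro x
      rw [foldAction, lift_gen, foldRefl_apply]
      split_ifs with h
      · exact Or.inr ⟨Finset.mem_image_of_mem Prod.fst h,
          Finset.mem_image_of_mem Prod.fst (hD _ _ h)⟩
      · exact Or.inl rfl
    | mul a b ha hb =>
      intro x
      rw [map_mul, Equiv.Perm.mul_apply]
      rcases hb x with h | h
      · rw [h]; exact ha x
      · rcases ha (foldAction hD hconv b x) with h' | h'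
        · rw [h']; exact Or.inr h
        · exact Or.inr ⟨h.1, h'.2⟩
    | inv a ha =>
      intro x
      rw [map_inv]
      have h := ha ((foldAction hD hconv a)⁻¹ x)
      rw [show foldAction hD hconv a ((foldAction hD hconv a)⁻¹ x) = x from
        Equiv.apply_symm_apply _ x] at h
      exact h.imp Eq.symm And.symm
  rcases key x₀ with h | h
  · rw [h]; exact Finset.mem_insert_self _ _
  · exact Finset.mem_insert_of_mem h.2

section Separability

variable [MulAction (ReflectionGroup T.next) X]

lemma coverAction_apply (hact : ∀ k x, gen T.next k • x = T.refl k x)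
    (w : ReflectionGroup T.next) (x : X) (m : (X × ι → ZMod 2) ⧸ T.boundaries) :
    T.coverAction w (x, m) = (w • x, (T.coverAction w (x, 0)).2 + m) := by
  induction w using ReflectionGroup.induction generalizing x m with
  | one => simp
  | gen k =>
    rw [coverAction, lift_gen, hact]
    change (T.refl k x, T.edgeClass x k + m) = (T.refl k x, T.edgeClass x k + 0 + m)
    rw [add_zero]
  | mul a b ha hb =>
    rw [map_mul, Equiv.Perm.mul_apply, Equiv.Perm.mul_apply, hb x m, hb x 0, ha, ha _ (_ + 0),
      mul_smul, add_zero, add_assoc]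
  | inv a ha =>
    rcases hp : T.coverAction a⁻¹ (x, 0) with ⟨y, n⟩
    rw [map_inv, Equiv.Perm.inv_eq_iff_eq, ha, Prod.mk.injEq] at hp
    obtain ⟨rfl, hn⟩ := hp
    rw [map_inv, Equiv.Perm.inv_eq_iff_eq, ha, inv_smul_smul, ← add_assoc, ← hn, zero_add]

lemma cocycle_mul (hact : ∀ k x, gen T.next k • x = T.refl k x)
    (a b : ReflectionGroup T.next) (x : X) :
    T.cocycle (a * b) x = T.cocycle a (b • x) + T.cocycle b x := by
  rw [cocycle, map_mul, Equiv.Perm.mul_apply, coverAction_apply hact b, coverAction_apply hact a,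
    add_zero]
  rfl

lemma cocycle_inv (hact : ∀ k x, gen T.next k • x = T.refl k x)
    (a : ReflectionGroup T.next) (x : X) :
    T.cocycle a⁻¹ (a • x) = T.cocycle a x := by
  have h := cocycle_mul hact a⁻¹ a x
  rw [inv_mul_cancel, cocycle_one] at h
  rw [← sub_eq_zero, sub_eq_add_neg, ZModModule.neg_eq_self, h]

/-- If the stabilizer of a tile is finitely generated then the homology is finite-dimensional. -/
lemma exists_finiteDimensional [Fintype ι] [MulAction.IsPretransitive (ReflectionGroup T.next) X]
    (hact : ∀ k x, gen T.next k • x = T.refl k x) (x₀ : X)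
    (hfg : (MulAction.stabilizer (ReflectionGroup T.next) x₀).FG) :
    ∃ Θ : Submodule (ZMod 2) ((X × ι → ZMod 2) ⧸ T.boundaries), FiniteDimensional (ZMod 2) Θ ∧
      ∀ f, T.EdgeSymm f → f.support.Finite → vertexSum f = 0 → T.boundaries.mkQ f ∈ Θ := by
  obtain ⟨S, hS⟩ := hfg
  set Θ := Submodule.span (ZMod 2)
    ((S.image fun h => T.cocycle h x₀ : Finset _) : Set ((X × ι → ZMod 2) ⧸ T.boundaries)) with hΘ
  refine ⟨Θ, FiniteDimensional.span_finset _ _, fun f hf hfin hsum => ?_⟩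
  have hmem : ∀ h, h • x₀ = x₀ → T.cocycle h x₀ ∈ Θ := by
    intro h hh
    rw [← MulAction.mem_stabilizer_iff, ← hS] at hh
    induction hh using Subgroup.closure_induction with
    | mem h hh => exact Submodule.subset_span (Finset.mem_coe.2 (Finset.mem_image_of_mem _ hh))
    | one => rw [cocycle_one]; exact Θ.zero_mem
    | mul a b ha hb ha' hb' =>
      rw [hS, MulAction.mem_stabilizer_iff] at hb
      rw [cocycle_mul hact, hb]
      exact Θ.add_mem ha' hb'
    | inv a ha ha' =>
      rw [hS, MulAction.mem_stabilizer_iff] at ha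
      have h := cocycle_inv hact a x₀
      rw [ha] at h
      rwa [h]
  choose σ hσ using fun x => MulAction.exists_smul_eq (ReflectionGroup T.next) x₀ x
  refine mkQ_mem_of_potential Θ (fun x => T.cocycle (σ x) x₀) (fun x k => ?_) hf hfin hsum
  have h := hmem ((σ (T.refl k x))⁻¹ * (gen T.next k * σ x)) (by
    rw [mul_smul, mul_smul, hσ, hact, inv_smul_eq_iff, hσ])
  rw [cocycle_mul hact, cocycle_mul hact, mul_smul, hσ, hact, cocycle_gen] at h
  nth_rewrite 2 [← hσ (T.refl k x)] at h
  rw [cocycle_inv hact] at h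
  convert h using 1
  abel

/-- On large sets of edges the folded action agrees with the original action. -/
lemma exists_foldAction_eq (hact : ∀ k x, gen T.next k • x = T.refl k x)
    (w : ReflectionGroup T.next) (x : X) :
    ∃ D₀, T.Reversible D₀ ∧ ∀ D (hD : T.Reversible D)
      (hconv : ∀ x k, (x, k) ∈ D → (x, T.next k) ∈ D → (x, k) ∈ T.corners D),
      D₀ ⊆ D → foldAction hD hconv w x = w • x := by
  induction w using ReflectionGroup.induction generalizing x with
  | one => exact ⟨∅, by intro x k h; simp at h, by simp⟩
  | gen k =>
    refine ⟨{(x, k), (T.refl k x, k)}, fun y l h => ?_, fun D hD hconv hsub => ?_⟩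
    · simp only [Finset.mem_insert, Finset.mem_singleton, Prod.mk.injEq] at h ⊢
      rcases h with ⟨rfl, rfl⟩ | ⟨rfl, rfl⟩ <;> simp [T.refl_refl]
    · have h : (x, k) ∈ D := hsub (by simp)
      rw [foldAction, lift_gen, foldRefl_apply, if_pos h, hact]
  | mul a b ha hb =>
    obtain ⟨D₁, h1, h1'⟩ := hb x
    obtain ⟨D₂, h2, h2'⟩ := ha (b • x)
    refine ⟨D₁ ∪ D₂, fun y l h => ?_, fun D hD hconv hsub => ?_⟩
    · rw [Finset.mem_union] at h ⊢
      exact h.imp (h1 y l) (h2 y l)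
    · rw [Finset.union_subset_iff] at hsub
      rw [map_mul, Equiv.Perm.mul_apply, h1' D hD hconv hsub.1, h2' D hD hconv hsub.2, mul_smul]
  | inv a ha =>
    obtain ⟨D₁, h1, h1'⟩ := ha (a⁻¹ • x)
    refine ⟨D₁, h1, fun D hD hconv hsub => ?_⟩
    rw [map_inv, Equiv.Perm.inv_eq_iff_eq, h1' D hD hconv hsub, smul_inv_smul]

lemma exists_foldAction_eq_of_finset (hact : ∀ k x, gen T.next k • x = T.refl k x)
    (S : Finset (ReflectionGroup T.next)) (x : X) :
    ∃ D₀, T.Reversible D₀ ∧ ∀ D (hD : T.Reversible D)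
      (hconv : ∀ x k, (x, k) ∈ D → (x, T.next k) ∈ D → (x, k) ∈ T.corners D),
      D₀ ⊆ D → ∀ w ∈ S, foldAction hD hconv w x = w • x := by
  choose D₀ h1 h2 using fun w => exists_foldAction_eq hact w x
  refine ⟨S.biUnion D₀, fun y l h => ?_, fun D hD hconv hsub w hw => h2 w D hD hconv
    ((Finset.subset_biUnion_of_mem D₀ hw).trans hsub)⟩
  rw [Finset.mem_biUnion] at h ⊢
  obtain ⟨w, hw, h⟩ := h
  exact ⟨w, hw, h1 w y l h⟩

/-- Stabilizers of tiles are separable when finitely generated. -/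
theorem exists_finiteIndex [Fintype ι] [MulAction.IsPretransitive (ReflectionGroup T.next) X]
    (hact : ∀ k x, gen T.next k • x = T.refl k x)
    (hnext : ∀ K : Finset ι, K.Nonempty → (∀ k ∈ K, T.next k ∈ K) → 5 ≤ K.card) (x₀ : X)
    (hfg : (MulAction.stabilizer (ReflectionGroup T.next) x₀).FG)
    {w : ReflectionGroup T.next} (hw : w • x₀ ≠ x₀) :
    ∃ K : Subgroup (ReflectionGroup T.next), K.FiniteIndex ∧
      MulAction.stabilizer (ReflectionGroup T.next) x₀ ≤ K ∧ w ∉ K := by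
  obtain ⟨Θ, hΘ, hΘ'⟩ := exists_finiteDimensional hact x₀ hfg
  obtain ⟨S, hS⟩ := hfg
  obtain ⟨D₀, hD₀, hfold⟩ := exists_foldAction_eq_of_finset hact (insert w S) x₀
  obtain ⟨D, hD, hsub, hconv⟩ := T.exists_locallyConvex hnext Θ hΘ' hD₀
  replace hfold := hfold D hD hconv hsub
  set φ := foldAction hD hconv
  refine ⟨(MulAction.stabilizer (Equiv.Perm X) x₀).comap φ, ?_, ?_, ?_⟩
  · have : Finite (ReflectionGroup T.next ⧸ (MulAction.stabilizer (Equiv.Perm X) x₀).comap φ) := by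
      let F : ReflectionGroup T.next → (insert x₀ (D.image Prod.fst) : Finset X) :=
        fun v => ⟨φ v x₀, foldAction_mem hD hconv v x₀⟩
      refine Finite.of_injective (fun v => F v.out) fun u v h => ?_
      have h' : φ u.out x₀ = φ v.out x₀ := congrArg Subtype.val h
      rw [← QuotientGroup.out_eq' u, ← QuotientGroup.out_eq' v, QuotientGroup.eq,
        Subgroup.mem_comap, MulAction.mem_stabilizer_iff, map_mul, map_inv, mul_smul,
        inv_smul_eq_iff]
      exact h'.symm
    exact Subgroup.finiteIndex_of_finite_quotient
  · rw [← hS, Subgroup.closure_le]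
    intro h hh
    have hh' : h • x₀ = x₀ := by
      rw [← MulAction.mem_stabilizer_iff, ← hS]; exact Subgroup.subset_closure hh
    exact (hfold h (Finset.mem_insert_of_mem hh)).trans hh'
  · intro h
    exact hw ((hfold w (Finset.mem_insert_self _ _)).symm.trans h)

end Separability

end TileSystem

namespace ReflectionGroup

variable {ι : Type*} {next : Equiv.Perm ι}

/-- Finitely generated parity-preserving subgroups of reflection groups are separable. -/
theorem exists_finiteIndex [Fintype ι] {color : ι → Bool} (hcolor : ∀ k, color (next k) = !color k)
    (hnext : ∀ K : Finset ι, K.Nonempty → (∀ k ∈ K, next k ∈ K) → 5 ≤ K.card)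
    {H : Subgroup (ReflectionGroup next)} (hH : H ≤ (parity color).ker) (hfg : H.FG)
    {w : ReflectionGroup next} (hw : w ∉ H) :
    ∃ K : Subgroup (ReflectionGroup next), K.FiniteIndex ∧ H ≤ K ∧ w ∉ K := by
  have hstab : MulAction.stabilizer (ReflectionGroup next)
      ((1 : ReflectionGroup next) : ReflectionGroup next ⧸ H) = H :=
    MulAction.stabilizer_quotient H
  have h := TileSystem.exists_finiteIndex (T := tiling hcolor hH) (fun _ _ => rfl) hnext
    ((1 : ReflectionGroup next) : ReflectionGroup next ⧸ H) (by rw [hstab]; exact hfg) (w := w)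
    (by rwa [← hstab, MulAction.mem_stabilizer_iff] at hw)
  rwa [hstab] at h

/-- The cyclic order on the sides of a right-angled polygon with `2 * (g + 1)` sides. -/
def polygonNext (g : ℕ) : Equiv.Perm (Fin (g + 1) × Bool) where
  toFun p := bif p.2 then (p.1 + 1, false) else (p.1, true)
  invFun p := bif p.2 then (p.1, false) else (p.1 - 1, true)
  left_inv := by rintro ⟨i, _ | _⟩ <;> simp
  right_inv := by rintro ⟨i, _ | _⟩ <;> simp

lemma polygonNext_false {g : ℕ} (i : Fin (g + 1)) : polygonNext g (i, false) = (i, true) := rfl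

lemma polygonNext_true {g : ℕ} (i : Fin (g + 1)) : polygonNext g (i, true) = (i + 1, false) := rfl

lemma two_mul_le_card_of_polygonNext_mem {g : ℕ} {K : Finset (Fin (g + 1) × Bool)}
    (hK : K.Nonempty) (h : ∀ k ∈ K, polygonNext g k ∈ K) : 2 * (g + 1) ≤ K.card := by
  obtain ⟨i, hi⟩ : ∃ i, (i, false) ∈ K := by
    obtain ⟨⟨i, _ | _⟩, hi⟩ := hK
    · exact ⟨i, hi⟩
    · exact ⟨i + 1, h _ hi⟩
  have h1 : ∀ m : Fin (g + 1), (i + m, false) ∈ K := by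
    intro m
    induction m using Fin.induction with
    | zero => simpa using hi
    | succ m ih =>
      have := h _ (h _ ih)
      rwa [polygonNext_false, polygonNext_true, add_assoc, Fin.coeSucc_eq_succ] at this
  have h2 : ∀ j, (j, false) ∈ K := by
    intro j
    have := h1 (j - i)
    rwa [add_sub_cancel] at this
  have h3 : K = Finset.univ := by
    refine Finset.eq_univ_of_forall ?_
    rintro ⟨j, _ | _⟩
    · exact h2 j
    · exact h _ (h2 j)
  rw [h3, Finset.card_univ, Fintype.card_prod, Fintype.card_fin, Fintype.card_bool, mul_comm]

end ReflectionGroup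

section Products

variable {Γ : Type*} [Group Γ]

lemma prod_ofFn_mul_inv {n : ℕ} (t : Fin (n + 1) → Γ) :
    (List.ofFn fun i : Fin n => t i.castSucc * (t i.succ)⁻¹).prod = t 0 * (t (Fin.last n))⁻¹ := by
  induction n with
  | zero => simp
  | succ n ih =>
    rw [List.ofFn_succ, List.prod_cons]
    have := ih fun i => t i.succ
    simp only [Fin.succ_last, Fin.succ_castSucc] at this ⊢
    rw [this]
    simp

/-- The product of the terms of a finite sequence from a given index on. -/
def tailProd {n : ℕ} (f : Fin n → Γ) (i : Fin (n + 1)) : Γ := ((List.ofFn f).drop i).prod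

lemma tailProd_castSucc {n : ℕ} (f : Fin n → Γ) (i : Fin n) :
    tailProd f i.castSucc = f i * tailProd f i.succ := by
  rw [tailProd, tailProd, Fin.val_castSucc, List.drop_eq_getElem_cons (by simp), List.prod_cons]
  simp

lemma tailProd_last {n : ℕ} (f : Fin n → Γ) : tailProd f (Fin.last n) = 1 := by
  rw [tailProd, List.drop_of_length_le (by simp), List.prod_nil]

lemma tailProd_zero {n : ℕ} (f : Fin n → Γ) : tailProd f 0 = (List.ofFn f).prod := by
  simp [tailProd]

/-- Exchange the two columns of a two by two array of copies of `Γ`. -/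
def columnFlip (A A' : Γ) : Equiv.Perm (Γ × Bool × Bool) :=
  Function.Involutive.toPerm (fun p => ((bif p.2.1 then (bif p.2.2 then A' else A)
    else (bif p.2.2 then A'⁻¹ else A⁻¹)) * p.1, !p.2.1, p.2.2))
    (by rintro ⟨u, _ | _, _ | _⟩ <;> simp)

lemma columnFlip_apply (A A' : Γ) (p : Γ × Bool × Bool) :
    columnFlip A A' p = ((bif p.2.1 then (bif p.2.2 then A' else A)
      else (bif p.2.2 then A'⁻¹ else A⁻¹)) * p.1, !p.2.1, p.2.2) := rfl

/-- Exchange the two rows of a two by two array of copies of `Γ`. -/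
def rowFlip (B y : Γ) : Equiv.Perm (Γ × Bool × Bool) :=
  Function.Involutive.toPerm (fun p => ((bif p.2.2 then (bif p.2.1 then y else B)
    else (bif p.2.1 then y⁻¹ else B⁻¹)) * p.1, p.2.1, !p.2.2))
    (by rintro ⟨u, _ | _, _ | _⟩ <;> simp)

lemma rowFlip_apply (B y : Γ) (p : Γ × Bool × Bool) :
    rowFlip B y p = ((bif p.2.2 then (bif p.2.1 then y else B)
      else (bif p.2.1 then y⁻¹ else B⁻¹)) * p.1, p.2.1, !p.2.2) := rfl

lemma columnFlip_mul_self (A A' : Γ) : columnFlip A A' * columnFlip A A' = 1 :=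
  Equiv.ext fun p => Function.Involutive.toPerm_involutive _ p

lemma rowFlip_mul_self (B y : Γ) : rowFlip B y * rowFlip B y = 1 :=
  Equiv.ext fun p => Function.Involutive.toPerm_involutive _ p

lemma columnFlip_mul_rowFlip {A A' B y : Γ} (h : A * y = B * A') :
    columnFlip A A' * rowFlip B y = rowFlip B y * columnFlip A A' := by
  obtain rfl : A = B * A' * y⁻¹ := eq_mul_inv_of_mul_eq h
  refine Equiv.ext ?_
  rintro ⟨u, _ | _, _ | _⟩ <;>
    simp [columnFlip_apply, rowFlip_apply, mul_assoc]

end Products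

namespace SurfaceGroup

open ReflectionGroup

variable {g : ℕ}

/-- The generators `aᵢ`. -/
def genA (i : Fin g) : SurfaceGroup g := PresentedGroup.of (i, false)

/-- The generators `bᵢ`. -/
def genB (i : Fin g) : SurfaceGroup g := PresentedGroup.of (i, true)

lemma induction {P : SurfaceGroup g → Prop} (x : SurfaceGroup g) (one : P 1)
    (genA : ∀ i, P (genA i)) (genB : ∀ i, P (genB i))
    (mul : ∀ a b, P a → P b → P (a * b)) (inv : ∀ a, P a → P a⁻¹) : P x := by
  have hx : x ∈ Subgroup.closure (Set.range (PresentedGroup.of : _ → SurfaceGroup g)) := by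
    rw [PresentedGroup.closure_range_of]; trivial
  induction hx using Subgroup.closure_induction with
  | mem x hx =>
    obtain ⟨⟨i, _ | _⟩, rfl⟩ := hx
    · exact genA i
    · exact genB i
  | one => exact one
  | mul x y _ _ hx hy => exact mul x y hx hy
  | inv x _ hx => exact inv x hx

/-- The commutators of the generators. -/
def commutator (i : Fin g) : SurfaceGroup g := genA i * genB i * (genA i)⁻¹ * (genB i)⁻¹

lemma tailProd_commutator_zero : tailProd (commutator (g := g)) 0 = 1 := by
  have h : PresentedGroup.mk {surfaceRelator g} (surfaceRelator g) = 1 :=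
    PresentedGroup.one_of_mem (Set.mem_singleton _)
  rw [surfaceRelator, map_list_prod, List.map_ofFn] at h
  rw [tailProd_zero]
  exact h

/-- Horizontal gluing elements. -/
def colA : Fin (g + 1) → SurfaceGroup g := tailProd genA

/-- Horizontal gluing elements in the other row. -/
def colA' (i : Fin (g + 1)) : SurfaceGroup g := (tailProd commutator i)⁻¹ * colA i

/-- Vertical gluing elements. -/
def rowY : Fin (g + 1) → SurfaceGroup g :=
  Fin.lastCases 1 fun i => (colA i.succ)⁻¹ * (genB i)⁻¹ * colA i.succ

/-- Vertical gluing elements in the other column. -/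
def rowB (i : Fin (g + 1)) : SurfaceGroup g := colA i * rowY i * (colA' i)⁻¹

lemma rowY_last : rowY (Fin.last g) = 1 := Fin.lastCases_last

lemma rowY_castSucc (i : Fin g) :
    rowY i.castSucc = (colA i.succ)⁻¹ * (genB i)⁻¹ * colA i.succ := Fin.lastCases_castSucc _

lemma colA_castSucc (i : Fin g) : colA i.castSucc = genA i * colA i.succ := tailProd_castSucc _ _

lemma colA_mul_rowY (i : Fin (g + 1)) : colA i * rowY i = rowB i * colA' i := by simp [rowB]

lemma colA_add_one_mul_rowY (i : Fin (g + 1)) :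
    colA (i + 1) * rowY i = rowB i * colA' (i + 1) := by
  induction i using Fin.lastCases with
  | last =>
    simp [rowB, colA', rowY_last, tailProd_commutator_zero, tailProd_last]
  | cast i =>
    rw [Fin.coeSucc_eq_succ, rowB, colA', colA', rowY_castSucc, colA_castSucc, tailProd_castSucc,
      commutator]
    group

/-- The orbifold fundamental group of the polygon acting on four copies of the surface group. -/
def polygonAction (g : ℕ) :
    ReflectionGroup (polygonNext g) →* Equiv.Perm (SurfaceGroup g × Bool × Bool) :=
  lift (fun k => bif k.2 then rowFlip (rowB k.1) (rowY k.1) else columnFlip (colA k.1) (colA' k.1))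
    (by
      rintro ⟨i, _ | _⟩
      · exact columnFlip_mul_self _ _
      · exact rowFlip_mul_self _ _)
    (by
      rintro ⟨i, _ | _⟩
      · exact columnFlip_mul_rowFlip (colA_mul_rowY i)
      · exact (columnFlip_mul_rowFlip (colA_add_one_mul_rowY i)).symm)

lemma polygonAction_false (i : Fin (g + 1)) :
    polygonAction g (gen _ (i, false)) = columnFlip (colA i) (colA' i) := lift_gen _ _ _ _

lemma polygonAction_true (i : Fin (g + 1)) :
    polygonAction g (gen _ (i, true)) = rowFlip (rowB i) (rowY i) := lift_gen _ _ _ _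

/-- The images of the generators of the surface group in the reflection group. -/
def reflectionWord (k : Fin g × Bool) : ReflectionGroup (polygonNext g) :=
  bif k.2 then gen _ (k.1.succ, false) * gen _ (Fin.last g, true) * gen _ (k.1.castSucc, true) *
    gen _ (k.1.succ, false)
  else gen _ (k.1.castSucc, false) * gen _ (k.1.succ, false)

lemma commutator_word {Γ : Type*} [Group Γ] {p p' q r : Γ} (hp : p * p = 1) (hp' : p' * p' = 1)
    (hq : q * q = 1) (hr : r * r = 1) (h : p * q = q * p) (h' : q * p' = p' * q) :
    p * p' * (p' * r * q * p') * (p * p')⁻¹ * (p' * r * q * p')⁻¹ =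
      p * r * p⁻¹ * (p' * r * p'⁻¹)⁻¹ := by
  have e : ∀ {x : Γ}, x * x = 1 → x⁻¹ = x := fun hx => inv_eq_of_mul_eq_one_left hx
  have c : ∀ {x : Γ}, x * x = 1 → ∀ z, x * (x * z) = z := fun hx z => by
    rw [← mul_assoc, hx, one_mul]
  simp only [mul_inv_rev, e hp, e hp', e hq, e hr, mul_assoc, c hp']
  have h1 : ∀ z, q * (p * z) = p * (q * z) := fun z => by rw [← mul_assoc, ← h, mul_assoc]
  have h2 : ∀ z, q * (p' * z) = p' * (q * z) := fun z => by rw [← mul_assoc, h', mul_assoc]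
  rw [h1, h2, c hq]

/-- The surface group as a subgroup of the reflection group. -/
def toReflectionGroup (g : ℕ) : SurfaceGroup g →* ReflectionGroup (polygonNext g) :=
  PresentedGroup.toGroup (f := reflectionWord) (by
    rintro _ rfl
    rw [surfaceRelator, map_list_prod, List.map_ofFn]
    have h : ∀ i : Fin g, _ = _ := fun i => commutator_word
      (gen_mul_self (next := polygonNext g) (i.castSucc, false))
      (gen_mul_self (next := polygonNext g) (i.succ, false))
      (gen_mul_self (next := polygonNext g) (i.castSucc, true))
      (gen_mul_self (next := polygonNext g) (Fin.last g, true))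
      (gen_comm (next := polygonNext g) (i.castSucc, false))
      (by
        have := gen_comm (next := polygonNext g) (i.castSucc, true)
        rwa [polygonNext_true, Fin.coeSucc_eq_succ] at this)
    have h' := prod_ofFn_mul_inv fun i : Fin (g + 1) => gen (polygonNext g) (i, false) *
      gen _ (Fin.last g, true) * (gen _ (i, false))⁻¹
    have h0 := gen_comm (next := polygonNext g) (Fin.last g, true)
    have h1 := gen_comm (next := polygonNext g) (Fin.last g, false)
    rw [polygonNext_true, Fin.last_add_one] at h0
    rw [polygonNext_false] at h1
    rw [← h0, h1, mul_inv_cancel_right, mul_inv_cancel_right, mul_inv_cancel] at h'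
    rw [← h']
    congr 2
    funext i
    rw [← h i]
    simp [reflectionWord])

lemma toReflectionGroup_genA (i : Fin g) : toReflectionGroup g (genA i) =
    gen _ (i.castSucc, false) * gen _ (i.succ, false) := PresentedGroup.toGroup.of _

lemma toReflectionGroup_genB (i : Fin g) : toReflectionGroup g (genB i) =
    gen _ (i.succ, false) * gen _ (Fin.last g, true) * gen _ (i.castSucc, true) *
      gen _ (i.succ, false) := PresentedGroup.toGroup.of _

lemma parity_toReflectionGroup (x : SurfaceGroup g) :
    parity Prod.snd (toReflectionGroup g x) = 1 := by
  have h : ∀ b (c d : Fin (g + 1)), parity Prod.snd (gen (polygonNext g) (c, b)) *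
      parity Prod.snd (gen (polygonNext g) (d, b)) = 1 := fun b c d => by
    rw [parity_gen, parity_gen, ← Pi.mulSingle_mul]
    exact Pi.mulSingle_one _
  induction x using SurfaceGroup.induction with
  | one => simp
  | genA i => rw [toReflectionGroup_genA, map_mul, h]
  | genB i =>
    rw [toReflectionGroup_genB, map_mul, map_mul, map_mul, mul_assoc (parity _ _), h, mul_one, h]
  | mul a b ha hb => rw [map_mul, map_mul, ha, hb, one_mul]
  | inv a ha => rw [map_inv, map_inv, ha, inv_one]

lemma polygonAction_toReflectionGroup (x u : SurfaceGroup g) :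
    polygonAction g (toReflectionGroup g x) (u, false, false) = (x * u, false, false) := by
  induction x using SurfaceGroup.induction generalizing u with
  | one => simp
  | genA i =>
    rw [toReflectionGroup_genA, map_mul, polygonAction_false, polygonAction_false, colA_castSucc]
    simp [columnFlip_apply, mul_assoc]
  | genB i =>
    rw [toReflectionGroup_genB, map_mul, map_mul, map_mul, polygonAction_false, polygonAction_true,
      polygonAction_true, rowY_last, rowY_castSucc]
    simp [columnFlip_apply, rowFlip_apply, mul_assoc]
  | mul a b ha hb => rw [map_mul, map_mul, Equiv.Perm.mul_apply, hb, ha, mul_assoc]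
  | inv a ha => rw [map_inv, map_inv, Equiv.Perm.inv_eq_iff_eq, ha, mul_inv_cancel_left]

lemma toReflectionGroup_injective : Function.Injective (toReflectionGroup g) := by
  intro x y h
  have := polygonAction_toReflectionGroup x 1
  rw [h, polygonAction_toReflectionGroup] at this
  simpa using this.symm

end SurfaceGroup

/-- Scott's theorem: for `g ≥ 2` the genus-`g` surface group is LERF (subgroup separable):
every finitely generated subgroup is the intersection of the finite index subgroups
containing it. -/
theorem surfaceGroup_lerf (g : ℕ) (hg : 2 ≤ g)
    (H : Subgroup (SurfaceGroup g)) (hH : H.FG)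
    (γ : SurfaceGroup g) (hγ : γ ∉ H) :
    ∃ K : Subgroup (SurfaceGroup g), K.FiniteIndex ∧ H ≤ K ∧ γ ∉ K := by
  set ρ := SurfaceGroup.toReflectionGroup g
  obtain ⟨K, hK, hHK, hγK⟩ := ReflectionGroup.exists_finiteIndex (color := Prod.snd)
    (next := ReflectionGroup.polygonNext g) (H := H.map ρ) (w := ρ γ)
    (by rintro ⟨i, _ | _⟩ <;> rfl)
    (fun K hK h => by
      have := ReflectionGroup.two_mul_le_card_of_polygonNext_mem hK h
      lia)
    (by
      rintro _ ⟨x, -, rfl⟩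
      exact SurfaceGroup.parity_toReflectionGroup x)
    ((Subgroup.fg_iff_submonoid_fg _).2 (((Subgroup.fg_iff_submonoid_fg H).1 hH).map ρ))
    (by rwa [Subgroup.mem_map_iff_mem SurfaceGroup.toReflectionGroup_injective])
  exact ⟨K.comap ρ, ⟨by
    rw [Subgroup.index_comap]
    exact Subgroup.FiniteIndex.index_ne_zero (H := K.subgroupOf ρ.range)⟩,
    Subgroup.map_le_iff_le_comap.1 hHK, hγK⟩
end

section
/- For every g ≥ 2 and every nontrivial element γ of the genus-g surface group π₁(S_g), the centralizer of γ in π₁(S_g) is a cyclic group: there exists z ∈ π₁(S_g) such that every element commuting with γ is an integer power of z. -/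
section Magnus

variable {X : Type*} [DecidableEq X]

/-- Left multiplication of a noncommutative power series, given by its coefficients, by the
series `1 + i`. -/
def magnusFun (i : X) (f : List X → ℤ) : List X → ℤ
  | [] => f []
  | j :: w => f (j :: w) + if j = i then f w else 0

/-- Left multiplication of a noncommutative power series by the inverse of `1 + i`. -/
def magnusInv (i : X) (f : List X → ℤ) : List X → ℤ
  | [] => f []
  | j :: w => f (j :: w) - if j = i then magnusInv i f w else 0

/-- The invertible operator of left multiplication by `1 + i`. -/
def magnusUnit (i : X) : (Module.End ℤ (List X → ℤ))ˣ where
  val :=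
    { toFun := magnusFun i
      map_add' f g := by
        ext (_ | ⟨j, w⟩)
        · rfl
        · simp only [magnusFun, Pi.add_apply]; split_ifs <;> ring
      map_smul' c f := by
        ext (_ | ⟨j, w⟩)
        · rfl
        · simp [magnusFun, mul_add] }
  inv :=
    { toFun := magnusInv i
      map_add' f g := by
        ext w
        induction w with
        | nil => rfl
        | cons j w ih =>
          simp only [magnusInv, Pi.add_apply, ih]; split_ifs <;> ring
      map_smul' c f := by
        ext w
        induction w with
        | nil => rfl
        | cons j w ih =>
          change _ = c * magnusInv i f (j :: w)
          simp only [magnusInv, ih, Pi.smul_apply, smul_eq_mul, RingHom.id_apply]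
          split_ifs <;> ring }
  val_inv := by
    ext f (_ | ⟨j, w⟩)
    · rfl
    · simp [magnusFun, magnusInv]
  inv_val := by
    ext f w
    change magnusInv i (magnusFun i f) w = f w
    induction w with
    | nil => rfl
    | cons j w ih => simp [magnusFun, magnusInv, ih]

theorem magnusUnit_cons (i : X) (f : List X → ℤ) (j : X) (w : List X) :
    (magnusUnit i).val f (j :: w) = f (j :: w) + if j = i then f w else 0 := rfl

theorem magnusUnit_inv_cons (i : X) (f : List X → ℤ) (j : X) (w : List X) :
    (magnusUnit i)⁻¹.val f (j :: w) =
      f (j :: w) - if j = i then (magnusUnit i)⁻¹.val f w else 0 := rfl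

/-- The Magnus representation of a free group by operators on noncommutative power series. -/
def magnus : FreeGroup X →* (Module.End ℤ (List X → ℤ))ˣ := FreeGroup.lift magnusUnit

theorem magnusUnit_zpow (i : X) (n : ℤ) (f : List X → ℤ) (v : List X) (hv : v.head? ≠ some i) :
    (magnusUnit i ^ n).val f v = f v ∧
      (magnusUnit i ^ n).val f (i :: v) = f (i :: v) + n * f v := by
  have h₁ (f : List X → ℤ) : (magnusUnit i).val f v = f v := by
    rcases v with _ | ⟨j, v⟩
    · rfl
    · have : j ≠ i := by simpa using hv
      simp [magnusUnit_cons, this]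
  have h₂ (f : List X → ℤ) : (magnusUnit i)⁻¹.val f v = f v := by
    rcases v with _ | ⟨j, v⟩
    · rfl
    · have : j ≠ i := by simpa using hv
      simp [magnusUnit_inv_cons, this]
  induction n using Int.induction_on generalizing f with
  | zero => simp
  | succ n ih =>
    rw [zpow_add_one, Units.val_mul, Module.End.mul_apply, (ih _).1, (ih _).2, h₁,
      magnusUnit_cons]
    refine ⟨rfl, ?_⟩
    simp; ring
  | pred n ih =>
    rw [zpow_sub_one, Units.val_mul, Module.End.mul_apply, (ih _).1, (ih _).2, h₂,
      magnusUnit_inv_cons]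
    refine ⟨rfl, ?_⟩
    rw [h₂]
    simp; ring

/-- The power series whose longest monomials without equal adjacent letters start with `i`. -/
def magnusPingPong (i : X) : Set (List X → ℤ) :=
  {f | ∃ v, (i :: v).IsChain (· ≠ ·) ∧ f (i :: v) ≠ 0 ∧
    ∀ u : List X, u.IsChain (· ≠ ·) → v.length + 1 ≤ u.length → f u ≠ 0 →
      u.head? = some i ∧ u.length = v.length + 1}

theorem magnus_injective [Nontrivial X] : Function.Injective (magnus (X := X)) := by
  have key : magnus (X := X) =
      (Monoid.CoprodI.lift fun i => FreeGroup.lift fun _ : Unit => magnusUnit i).comp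
        (freeGroupEquivCoprodI (ι := X)).toMonoidHom := by
    ext1 i
    simp [magnus]
  rw [key, MonoidHom.coe_comp]
  refine Function.Injective.comp ?_ (MulEquiv.injective _)
  refine Monoid.CoprodI.lift_injective_of_ping_pong (α := List X → ℤ) _ ?_ magnusPingPong ?_ ?_ ?_
  · inhabit X
    right
    refine ⟨default, ?_⟩
    exact (Cardinal.ofNat_le_aleph0 (n := 3)).trans (Cardinal.aleph0_le_mk _)
  · intro i
    refine ⟨Pi.single [i] 1, [], by simp, by simp, ?_⟩
    intro u _ _ hu
    have : u = [i] := by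
      by_contra h
      simp [h] at hu
    simp [this]
  · intro i j hij
    refine Set.disjoint_left.2 ?_
    rintro f ⟨v, hv, hfv, hf⟩ ⟨v', hv', hfv', hf'⟩
    rcases le_total v.length v'.length with h | h
    · have := (hf _ hv' (by simpa using h) hfv').1
      simp at this
      exact hij this.symm
    · have := (hf' _ hv (by simpa using h) hfv).1
      simp at this
      exact hij this
  · intro i j hij h hne
    obtain ⟨n, rfl⟩ : ∃ n : ℤ, h = FreeGroup.of () ^ n :=
      ⟨FreeGroup.freeGroupUnitEquivInt h,
        (FreeGroup.freeGroupUnitEquivInt.symm_apply_apply h).symm⟩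
    have hn : n ≠ 0 := by
      rintro rfl
      exact hne (zpow_zero _)
    rw [map_zpow, FreeGroup.lift_apply_of]
    rintro _ ⟨f, ⟨v, hv, hfv, hf⟩, rfl⟩
    change (magnusUnit i ^ n).val f ∈ magnusPingPong i
    have hchain : (i :: j :: v).IsChain (· ≠ ·) := List.IsChain.cons_cons hij hv
    have hzero : ∀ u : List X, u.IsChain (· ≠ ·) → v.length + 1 < u.length → f u = 0 := by
      intro u hu hl
      by_contra h
      have := (hf u hu hl.le h).2
      omega
    refine ⟨j :: v, hchain, ?_, ?_⟩
    · rw [(magnusUnit_zpow i n f (j :: v) (by simpa using hij.symm)).2,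
        hzero _ hchain (by simp)]
      simpa using ⟨hn, hfv⟩
    · intro u hu hl hne
      simp only [List.length_cons] at hl ⊢
      by_cases hh : u.head? = some i
      · obtain ⟨u, rfl⟩ : ∃ u', u = i :: u' := by
          rcases u with _ | ⟨k, u⟩
          · simp at hh
          · exact ⟨u, by simpa using hh⟩
        have hu' : u.head? ≠ some i := by
          rcases u with _ | ⟨k, u⟩
          · simp
          · have := (List.isChain_cons_cons.1 hu).1
            simpa using this.symm
        rw [(magnusUnit_zpow i n f u hu').2, hzero _ hu (by omega), zero_add] at hne
        simp only [List.length_cons] at hl ⊢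
        have := (hf u hu.tail (by omega) (right_ne_zero_of_mul hne)).2
        exact ⟨rfl, by omega⟩
      · rw [(magnusUnit_zpow i n f u hh).1] at hne
        exact absurd (hzero u hu (by omega)) hne
end Magnus

section GroupRing

variable {X : Type*}

/-- The augmentation ideal of the integral group ring of a free group, as an additive group. -/
noncomputable def augIdeal (X : Type*) : Submodule ℤ (MonoidAlgebra ℤ (FreeGroup X)) :=
  Submodule.span ℤ (Set.range fun g : FreeGroup X => MonoidAlgebra.of ℤ _ g - 1)

theorem of_sub_one_mem_augIdeal (g : FreeGroup X) :
    MonoidAlgebra.of ℤ _ g - 1 ∈ augIdeal X :=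
  Submodule.subset_span ⟨g, rfl⟩

/-- The span of the elements `x - 1` for the free generators `x`. -/
noncomputable def generatorSpan (X : Type*) : Submodule ℤ (MonoidAlgebra ℤ (FreeGroup X)) :=
  Submodule.span ℤ (Set.range fun x : X => MonoidAlgebra.of ℤ _ (FreeGroup.of x) - 1)

theorem augIdeal_le : augIdeal X ≤ generatorSpan X ⊔ augIdeal X ^ 2 := by
  refine Submodule.span_le.2 ?_
  rintro _ ⟨g, rfl⟩
  have hmul (g h : FreeGroup X) :
      (MonoidAlgebra.of ℤ _ g - 1) * (MonoidAlgebra.of ℤ _ h - 1) ∈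
        generatorSpan X ⊔ augIdeal X ^ 2 :=
    Submodule.mem_sup_right <| pow_two (augIdeal X) ▸
      Submodule.mul_mem_mul (of_sub_one_mem_augIdeal g) (of_sub_one_mem_augIdeal h)
  change MonoidAlgebra.of ℤ _ g - 1 ∈ generatorSpan X ⊔ augIdeal X ^ 2
  induction g using FreeGroup.induction_on with
  | C1 => rw [map_one, sub_self]; exact zero_mem _
  | of x => exact Submodule.mem_sup_left (Submodule.subset_span ⟨x, rfl⟩)
  | inv_of x ih =>
    have := add_mem ih (hmul (FreeGroup.of x) (FreeGroup.of x)⁻¹)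
    rw [← neg_mem_iff]
    convert this using 1
    rw [sub_mul, mul_sub, ← map_mul, mul_inv_cancel, map_one]
    noncomm_ring
  | mul g h ihg ihh =>
    convert add_mem (add_mem ihg ihh) (hmul g h) using 1
    rw [map_mul]
    noncomm_ring

theorem augIdeal_pow_le (k : ℕ) :
    augIdeal X ^ k ≤ generatorSpan X ^ k ⊔ augIdeal X ^ (k + 1) := by
  have hle : generatorSpan X ≤ augIdeal X := by
    refine Submodule.span_le.2 ?_
    rintro _ ⟨x, rfl⟩
    exact of_sub_one_mem_augIdeal _
  induction k with
  | zero => simp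
  | succ k ih =>
    calc augIdeal X ^ (k + 1) = augIdeal X * augIdeal X ^ k := pow_succ' _ k
      _ ≤ generatorSpan X * augIdeal X ^ k ⊔ augIdeal X ^ 2 * augIdeal X ^ k := by
        rw [← Submodule.sup_mul]
        exact mul_le_mul' augIdeal_le le_rfl
      _ ≤ generatorSpan X * (generatorSpan X ^ k ⊔ augIdeal X ^ (k + 1)) ⊔
          augIdeal X ^ (k + 2) := by
        rw [← pow_add, add_comm 2 k]
        exact sup_le_sup (mul_le_mul' le_rfl ih) le_rfl
      _ ≤ generatorSpan X ^ (k + 1) ⊔ augIdeal X ^ (k + 2) := by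
        rw [Submodule.mul_sup, ← pow_succ', sup_assoc]
        refine sup_le_sup le_rfl (sup_le ?_ le_rfl)
        rw [pow_succ' _ (k + 1)]
        exact mul_le_mul' hle le_rfl

end GroupRing

section MagnusCoeff

variable {X : Type*} [DecidableEq X]

/-- The exponent sum of a generator. -/
def expSum (x : X) : FreeGroup X →* Multiplicative ℤ :=
  FreeGroup.lift fun y => Multiplicative.ofAdd (if y = x then 1 else 0)

theorem expSum_of (x y : X) :
    (expSum x (FreeGroup.of y)).toAdd = if y = x then 1 else 0 := by
  simp [expSum]

theorem magnus_apply (g : FreeGroup X) (k : ℕ) (f : List X → ℤ)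
    (hf : ∀ v : List X, v.length < k → f v = 0) :
    (∀ v : List X, v.length ≤ k → (magnus g).val f v = f v) ∧
      ∀ x w, w.length = k →
        (magnus g).val f (x :: w) = f (x :: w) + (expSum x g).toAdd * f w := by
  induction g using FreeGroup.induction_on generalizing f with
  | C1 => simp
  | of y =>
    have h : magnus (FreeGroup.of y) = magnusUnit y := by simp [magnus]
    rw [h]
    refine ⟨?_, ?_⟩
    · rintro (_ | ⟨z, v⟩) hv
      · rfl
      · rw [magnusUnit_cons, hf v (by simpa using hv)]
        simp
    · intro x w _
      rw [magnusUnit_cons, expSum_of]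
      simp [eq_comm]
  | inv_of y _ =>
    have h : magnus (FreeGroup.of y)⁻¹ = (magnusUnit y)⁻¹ := by simp [magnus]
    rw [h]
    have h₁ : ∀ v : List X, v.length ≤ k → (magnusUnit y)⁻¹.val f v = f v := by
      intro v
      induction v with
      | nil => intro _; rfl
      | cons z v ih =>
        intro hv
        rw [List.length_cons] at hv
        rw [magnusUnit_inv_cons, ih (by omega), hf v (by omega)]
        simp
    refine ⟨h₁, ?_⟩
    intro x w hw
    rw [magnusUnit_inv_cons, h₁ w hw.le, map_inv, toAdd_inv, expSum_of]
    by_cases h : x = y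
    · subst h
      simp [sub_eq_add_neg]
    · simp [h, Ne.symm h]
  | mul g h ihg ihh =>
    have hf' : ∀ v : List X, v.length < k → (magnus h).val f v = 0 := fun v hv => by
      rw [(ihh f hf).1 v hv.le, hf v hv]
    rw [map_mul, Units.val_mul]
    refine ⟨?_, ?_⟩
    · intro v hv
      rw [Module.End.mul_apply, (ihg _ hf').1 v hv, (ihh f hf).1 v hv]
    · intro x w hw
      rw [Module.End.mul_apply, (ihg _ hf').2 x w hw, (ihh f hf).2 x w hw,
        (ihh f hf).1 w hw.le, map_mul, toAdd_mul]
      ring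

/-- The Magnus representation of the group ring of a free group. -/
noncomputable def magnusRep :
    MonoidAlgebra ℤ (FreeGroup X) →ₐ[ℤ] Module.End ℤ (List X → ℤ) :=
  MonoidAlgebra.lift ℤ _ _ ((Units.coeHom _).comp magnus)

theorem magnusRep_of (g : FreeGroup X) : magnusRep (MonoidAlgebra.of ℤ _ g) = (magnus g).val := by
  simp [magnusRep]

/-- The coefficient of the monomial `w` in the Magnus expansion. -/
noncomputable def magnusCoeff (w : List X) : MonoidAlgebra ℤ (FreeGroup X) →ₗ[ℤ] ℤ :=
  LinearMap.proj w ∘ₗ LinearMap.applyₗ (Pi.single [] 1) ∘ₗ magnusRep.toLinearMap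

theorem magnusCoeff_apply (w : List X) (a : MonoidAlgebra ℤ (FreeGroup X)) :
    magnusCoeff w a = magnusRep a (Pi.single [] 1) w := rfl

theorem magnusCoeff_singleton (x : X) (g : FreeGroup X) :
    magnusCoeff [x] (MonoidAlgebra.of ℤ _ g - 1) = (expSum x g).toAdd := by
  have := (magnus_apply g 0 (Pi.single [] 1) (by simp)).2 x [] rfl
  rw [magnusCoeff_apply, map_sub, map_one, LinearMap.sub_apply, Pi.sub_apply, magnusRep_of, this]
  simp

theorem magnusRep_augIdeal {b : MonoidAlgebra ℤ (FreeGroup X)} (hb : b ∈ augIdeal X) (k : ℕ)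
    (f : List X → ℤ) (hf : ∀ v : List X, v.length < k → f v = 0) :
    (∀ v : List X, v.length ≤ k → magnusRep b f v = 0) ∧
      ∀ x w, w.length = k → magnusRep b f (x :: w) = magnusCoeff [x] b * f w := by
  induction hb using Submodule.span_induction with
  | mem b hb =>
    obtain ⟨g, rfl⟩ := hb
    refine ⟨fun v hv => ?_, fun x w hw => ?_⟩
    · simp only [map_sub, map_one, LinearMap.sub_apply, Pi.sub_apply, magnusRep_of]
      rw [(magnus_apply g k f hf).1 v hv]
      simp
    · rw [magnusCoeff_singleton]
      simp only [map_sub, map_one, LinearMap.sub_apply, Pi.sub_apply, magnusRep_of]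
      rw [(magnus_apply g k f hf).2 x w hw]
      simp
  | zero => simp
  | add a b _ _ iha ihb =>
    refine ⟨fun v hv => ?_, fun x w hw => ?_⟩
    · simp [iha.1 v hv, ihb.1 v hv]
    · simp [iha.2 x w hw, ihb.2 x w hw, add_mul]
  | smul c a _ iha =>
    refine ⟨fun v hv => ?_, fun x w hw => ?_⟩
    · simp [iha.1 v hv]
    · simp only [map_smul, LinearMap.smul_apply, Pi.smul_apply, smul_eq_mul]
      rw [iha.2 x w hw, mul_assoc]

theorem magnusRep_augIdeal_pow {k : ℕ} {a : MonoidAlgebra ℤ (FreeGroup X)}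
    (ha : a ∈ augIdeal X ^ k) (f : List X → ℤ) (v : List X) (hv : v.length < k) :
    magnusRep a f v = 0 := by
  induction k generalizing a v with
  | zero => simp at hv
  | succ k ih =>
    rw [pow_succ'] at ha
    induction ha using Submodule.mul_induction_on' with
    | mem_mul_mem b hb c hc =>
      rw [map_mul, Module.End.mul_apply]
      exact (magnusRep_augIdeal hb k _ fun v hv => ih hc v hv).1 v (by omega)
    | add a _ b _ iha ihb => simp [iha, ihb]

theorem magnusCoeff_augIdeal_pow {k : ℕ} {a : MonoidAlgebra ℤ (FreeGroup X)}
    (ha : a ∈ augIdeal X ^ k) (v : List X) (hv : v.length < k) : magnusCoeff v a = 0 :=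
  magnusRep_augIdeal_pow ha _ v hv

theorem magnusCoeff_cons {b c : MonoidAlgebra ℤ (FreeGroup X)} (hb : b ∈ augIdeal X)
    (x : X) (w : List X) (hc : c ∈ augIdeal X ^ w.length) :
    magnusCoeff (x :: w) (b * c) = magnusCoeff [x] b * magnusCoeff w c := by
  rw [magnusCoeff_apply, map_mul, Module.End.mul_apply,
    (magnusRep_augIdeal hb w.length _ fun v hv => magnusRep_augIdeal_pow hc _ v hv).2 x w rfl]
  rfl

theorem magnusCoeff_concat {a b : MonoidAlgebra ℤ (FreeGroup X)} (hb : b ∈ augIdeal X)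
    (y : X) (w : List X) (ha : a ∈ augIdeal X ^ w.length) :
    magnusCoeff (w ++ [y]) (a * b) = magnusCoeff w a * magnusCoeff [y] b := by
  induction w generalizing a with
  | nil =>
    rw [List.length_nil, pow_zero] at ha
    obtain ⟨n, rfl⟩ := Submodule.mem_one.1 ha
    rw [List.nil_append, ← Algebra.smul_def, map_smul, smul_eq_mul]
    simp [magnusCoeff_apply]
  | cons x w ih =>
    rw [List.length_cons, pow_succ'] at ha
    induction ha using Submodule.mul_induction_on' with
    | mem_mul_mem c hc d hd =>
      rw [mul_assoc, List.cons_append, magnusCoeff_cons hc x (w ++ [y]), ih hd,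
        magnusCoeff_cons hc x w hd, mul_assoc]
      rw [List.length_append, List.length_singleton, pow_succ]
      exact Submodule.mul_mem_mul hd hb
    | add c _ d _ ihc ihd => simp only [add_mul, map_add, ihc, ihd]

/-- The product of the elements `x - 1` over the letters of a word. -/
noncomputable def magnusMonomial (v : List X) : MonoidAlgebra ℤ (FreeGroup X) :=
  (v.map fun x => MonoidAlgebra.of ℤ _ (FreeGroup.of x) - 1).prod

omit [DecidableEq X] in
theorem magnusMonomial_cons (x : X) (v : List X) :
    magnusMonomial (x :: v) =
      (MonoidAlgebra.of ℤ _ (FreeGroup.of x) - 1) * magnusMonomial v := by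
  simp [magnusMonomial]

omit [DecidableEq X] in
theorem magnusMonomial_mem (v : List X) : magnusMonomial v ∈ augIdeal X ^ v.length := by
  induction v with
  | nil =>
    rw [List.length_nil, pow_zero]
    exact Submodule.one_le.1 le_rfl
  | cons x v ih =>
    rw [magnusMonomial_cons, List.length_cons, pow_succ']
    exact Submodule.mul_mem_mul (of_sub_one_mem_augIdeal _) ih

theorem magnusCoeff_magnusMonomial (v w : List X) (h : w.length = v.length) :
    magnusCoeff w (magnusMonomial v) = if v = w then 1 else 0 := by
  induction v generalizing w with
  | nil =>
    obtain rfl := List.length_eq_zero_iff.1 h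
    simp [magnusMonomial, magnusCoeff_apply]
  | cons x v ih =>
    rcases w with _ | ⟨y, w⟩
    · simp at h
    have h : w.length = v.length := by simpa using h
    rw [magnusMonomial_cons, magnusCoeff_cons (of_sub_one_mem_augIdeal _) y w (h ▸ magnusMonomial_mem v),
      magnusCoeff_singleton, expSum_of, ih w h]
    split_ifs <;> simp_all

omit [DecidableEq X] in
theorem generatorSpan_pow_le (k : ℕ) :
    generatorSpan X ^ k ≤ Submodule.span ℤ (magnusMonomial '' {v : List X | v.length = k}) := by
  induction k with
  | zero =>
    rw [pow_zero, Submodule.one_eq_span]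
    refine Submodule.span_mono ?_
    rintro _ rfl
    exact ⟨[], rfl, by simp [magnusMonomial]⟩
  | succ k ih =>
    rw [pow_succ']
    refine (mul_le_mul' le_rfl ih).trans ?_
    rw [generatorSpan, Submodule.span_mul_span]
    refine Submodule.span_mono ?_
    rintro _ ⟨_, ⟨x, rfl⟩, _, ⟨v, hv, rfl⟩, rfl⟩
    exact ⟨x :: v, by simpa using hv, by simp [magnusMonomial]⟩

/-- The leading coefficients of an element of a power of the augmentation ideal. -/
theorem exists_magnusCoeff_eq (k : ℕ) {a : MonoidAlgebra ℤ (FreeGroup X)}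
    (ha : a ∈ augIdeal X ^ k) :
    ∃ c : List X →₀ ℤ, (∀ w ∈ c.support, w.length = k) ∧
      (∀ w, w.length = k → magnusCoeff w a = c w) ∧ (c = 0 → a ∈ augIdeal X ^ (k + 1)) := by
  obtain ⟨s, hs, t, ht, rfl⟩ := Submodule.mem_sup.1 (augIdeal_pow_le k ha)
  obtain ⟨c, hc, rfl⟩ := (Finsupp.mem_span_image_iff_linearCombination ℤ).1
    (generatorSpan_pow_le k hs)
  have hc' : ∀ w ∈ c.support, w.length = k := fun w hw => hc hw
  refine ⟨c, hc', fun w hw => ?_, fun h => ?_⟩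
  · rw [map_add, magnusCoeff_augIdeal_pow ht w (by omega), add_zero,
      Finsupp.linearCombination_apply, Finsupp.sum, map_sum]
    rw [Finset.sum_congr rfl (g := fun v => if v = w then c v else 0)]
    · simp +contextual [eq_comm]
    · intro v hv
      rw [map_smul, magnusCoeff_magnusMonomial v w (by rw [hw, hc' v hv])]
      simp
  · simpa [h] using ht

theorem exists_leading_magnusCoeff [Nontrivial X] {g : FreeGroup X} (hg : g ≠ 1) :
    ∃ k : ℕ, k ≠ 0 ∧ MonoidAlgebra.of ℤ _ g - 1 ∈ augIdeal X ^ k ∧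
      ∃ c : List X →₀ ℤ, c ≠ 0 ∧ (∀ w ∈ c.support, w.length = k) ∧
        ∀ w, w.length = k → magnusCoeff w (MonoidAlgebra.of ℤ _ g - 1) = c w := by
  have hex : ∃ k, MonoidAlgebra.of ℤ _ g - 1 ∉ augIdeal X ^ (k + 1) := by
    by_contra! h
    refine hg (magnus_injective ?_)
    rw [map_one]
    ext f w
    have := magnusRep_augIdeal_pow (h w.length) f w (by omega)
    rw [map_sub, map_one, LinearMap.sub_apply, Pi.sub_apply, magnusRep_of] at this
    exact sub_eq_zero.1 this
  classical
  have hk := Nat.find_spec hex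
  have hlt : ∀ m < Nat.find hex, _ := fun m hm => not_not.1 (Nat.find_min hex hm)
  generalize Nat.find hex = k at hk hlt
  have hk0 : k ≠ 0 := by
    rintro rfl
    exact hk (by simpa using of_sub_one_mem_augIdeal g)
  obtain ⟨m, rfl⟩ := Nat.exists_eq_succ_of_ne_zero hk0
  have hmem := hlt m (Nat.lt_succ_self m)
  obtain ⟨c, hc, hc', hc0⟩ := exists_magnusCoeff_eq (m + 1) hmem
  exact ⟨m + 1, hk0, hmem, c, fun h => hk (hc0 h), hc, hc'⟩

end MagnusCoeff

section FreeGroupCentralizer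

theorem FreeGroup.eq_one_of_commute_of {X : Type*} {x y : X} (hxy : x ≠ y) {g : FreeGroup X}
    (hx : Commute (FreeGroup.of x) g) (hy : Commute (FreeGroup.of y) g) : g = 1 := by
  classical
  have : Nontrivial X := ⟨x, y, hxy⟩
  by_contra hg
  obtain ⟨k, hk, ha, c, hc0, hck, hc⟩ := exists_leading_magnusCoeff hg
  obtain ⟨w, hw⟩ := Finsupp.support_nonempty_iff.2 hc0
  have hwk := hck w hw
  have hw0 : w ≠ [] := by
    rintro rfl
    exact hk hwk.symm
  have last (z : X) (hz : Commute (FreeGroup.of z) g) : w.getLast hw0 = z := by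
    set a := MonoidAlgebra.of ℤ _ g - 1
    set b := MonoidAlgebra.of ℤ _ (FreeGroup.of z) - 1
    have hcomm : b * a = a * b :=
      (((hz.map (MonoidAlgebra.of ℤ _)).sub_left (Commute.one_left _)).sub_right
        (Commute.one_right _)).eq
    have hb : b ∈ augIdeal X := of_sub_one_mem_augIdeal _
    have hne : magnusCoeff (z :: w) (b * a) ≠ 0 := by
      rw [magnusCoeff_cons hb z w (hwk ▸ ha), magnusCoeff_singleton, expSum_of, hc w hwk]
      simpa using hw
    have hsplit : z :: w = (z :: w.dropLast) ++ [w.getLast hw0] := by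
      rw [List.cons_append, List.dropLast_append_getLast]
    have hlen : (z :: w.dropLast).length = k := by
      have := congrArg List.length hsplit
      simp only [List.length_append, List.length_cons, List.length_nil, hwk] at this ⊢
      omega
    rw [hcomm, hsplit, magnusCoeff_concat hb _ _ (hlen ▸ ha), magnusCoeff_singleton,
      expSum_of] at hne
    by_contra h
    simp [Ne.symm h] at hne
  exact hxy ((last x hx).symm.trans (last y hy))

theorem FreeGroup.isCyclic_of_subsingleton (X : Type*) [Subsingleton X] :
    IsCyclic (FreeGroup X) := by
  rcases isEmpty_or_nonempty X with h | ⟨⟨x⟩⟩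
  · infer_instance
  · refine ⟨FreeGroup.of x, fun g => ?_⟩
    change g ∈ Subgroup.zpowers (FreeGroup.of x)
    induction g using FreeGroup.induction_on with
    | C1 => exact one_mem _
    | of y => exact Subsingleton.elim x y ▸ Subgroup.mem_zpowers _
    | inv_of y h => exact inv_mem h
    | mul g h hg hh => exact mul_mem hg hh

theorem FreeGroup.isCyclic_centralizer {X : Type*} {g : FreeGroup X} (hg : g ≠ 1) :
    IsCyclic (Subgroup.centralizer {g}) := by
  set C := Subgroup.centralizer {g}
  let e := IsFreeGroup.toFreeGroup C
  let g' : C := ⟨g, Subgroup.mem_centralizer_singleton_iff.2 rfl⟩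
  have hcomm (c : C) : Commute c g' :=
    Subtype.ext (Subgroup.mem_centralizer_singleton_iff.1 c.2)
  have hcomm' (u : FreeGroup (IsFreeGroup.Generators C)) : Commute u (e g') := by
    simpa using (hcomm (e.symm u)).map e
  have : Subsingleton (IsFreeGroup.Generators C) := by
    refine ⟨fun x y => ?_⟩
    by_contra hxy
    have := FreeGroup.eq_one_of_commute_of hxy (hcomm' _) (hcomm' _)
    rw [map_eq_one_iff e e.injective] at this
    exact hg (congrArg Subtype.val this)
  have := FreeGroup.isCyclic_of_subsingleton (IsFreeGroup.Generators C)
  exact isCyclic_of_injective e.toMonoidHom e.injective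

end FreeGroupCentralizer

section Endomorphism

variable {X : Type*} [DecidableEq X]

/-- The action of an endomorphism of a free group on its group ring. -/
noncomputable abbrev ringMap (θ : FreeGroup X →* FreeGroup X) :
    MonoidAlgebra ℤ (FreeGroup X) →ₐ[ℤ] MonoidAlgebra ℤ (FreeGroup X) :=
  MonoidAlgebra.mapDomainAlgHom ℤ ℤ θ

omit [DecidableEq X] in
theorem ringMap_of (θ : FreeGroup X →* FreeGroup X) (g : FreeGroup X) :
    ringMap θ (MonoidAlgebra.of ℤ _ g) = MonoidAlgebra.of ℤ _ (θ g) := by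
  simp [ringMap]

omit [DecidableEq X] in
theorem ringMap_mem (θ : FreeGroup X →* FreeGroup X) {a : MonoidAlgebra ℤ (FreeGroup X)} {k : ℕ}
    (ha : a ∈ augIdeal X ^ k) : ringMap θ a ∈ augIdeal X ^ k := by
  have h : (augIdeal X).map (ringMap θ).toLinearMap ≤ augIdeal X := by
    rw [augIdeal, Submodule.map_span_le]
    rintro _ ⟨g, rfl⟩
    simp only [AlgHom.toLinearMap_apply, map_sub, map_one, ringMap_of]
    exact of_sub_one_mem_augIdeal _
  refine pow_le_pow_left' h k ?_
  rw [← Submodule.map_pow]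
  exact Submodule.mem_map_of_mem ha

theorem magnusCoeff_ringMap (θ : FreeGroup X →* FreeGroup X) {w w' : List X}
    (hw : List.Forall₂ (fun x x' => (expSum x').comp θ = expSum x) w w')
    {a : MonoidAlgebra ℤ (FreeGroup X)} (ha : a ∈ augIdeal X ^ w.length) :
    magnusCoeff w' (ringMap θ a) = magnusCoeff w a := by
  induction hw generalizing a with
  | nil =>
    rw [List.length_nil, pow_zero] at ha
    obtain ⟨n, rfl⟩ := Submodule.mem_one.1 ha
    rw [AlgHom.commutes]
  | @cons x x' w w' hx hw ih =>
    rw [List.length_cons, pow_succ'] at ha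
    induction ha using Submodule.mul_induction_on' with
    | mem_mul_mem b hb c hc =>
      have hb' : ringMap θ b ∈ augIdeal X := by
        simpa using ringMap_mem θ (k := 1) (by simpa using hb)
      rw [map_mul, magnusCoeff_cons hb' x' w' (hw.length_eq ▸ ringMap_mem θ hc), ih hc,
        magnusCoeff_cons hb x w hc]
      congr 1
      clear hb'
      induction hb using Submodule.span_induction with
      | mem b hb =>
        obtain ⟨g, rfl⟩ := hb
        rw [map_sub, map_one, ringMap_of, magnusCoeff_singleton, magnusCoeff_singleton, ← hx]
        rfl
      | zero => simp
      | add a b _ _ iha ihb => simp only [map_add, iha, ihb]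
      | smul n a _ iha => simp only [map_smul, iha]
    | add c _ d _ ihc ihd => simp only [map_add, ihc, ihd]

/-- Leading coefficients are invariant under inner automorphisms. -/
theorem magnusCoeff_ringMap_of_conj (θ : FreeGroup X →* FreeGroup X) {f g : FreeGroup X}
    (h : f * θ g = g * f) (w : List X) (ha : MonoidAlgebra.of ℤ _ g - 1 ∈ augIdeal X ^ w.length) :
    magnusCoeff w (ringMap θ (MonoidAlgebra.of ℤ _ g - 1)) =
      magnusCoeff w (MonoidAlgebra.of ℤ _ g - 1) := by
  set a := MonoidAlgebra.of ℤ _ g - 1 with hadef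
  have hf : MonoidAlgebra.of ℤ _ f - 1 ∈ augIdeal X := of_sub_one_mem_augIdeal f
  have key : (MonoidAlgebra.of ℤ _ f - 1) * ringMap θ a + ringMap θ a =
      a * (MonoidAlgebra.of ℤ _ f - 1) + a := by
    have : MonoidAlgebra.of ℤ _ f * ringMap θ a = a * MonoidAlgebra.of ℤ _ f := by
      rw [hadef, map_sub, map_one, ringMap_of, mul_sub, sub_mul, ← map_mul, ← map_mul, h]
      simp
    rw [sub_mul, mul_sub, one_mul, mul_one, sub_add_cancel, sub_add_cancel, this]
  have h₁ : magnusCoeff w ((MonoidAlgebra.of ℤ _ f - 1) * ringMap θ a) = 0 := by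
    refine magnusCoeff_augIdeal_pow (k := w.length + 1) ?_ w (by omega)
    rw [pow_succ']
    exact Submodule.mul_mem_mul hf (ringMap_mem θ ha)
  have h₂ : magnusCoeff w (a * (MonoidAlgebra.of ℤ _ f - 1)) = 0 := by
    refine magnusCoeff_augIdeal_pow (k := w.length + 1) ?_ w (by omega)
    rw [pow_succ]
    exact Submodule.mul_mem_mul ha hf
  have := congrArg (magnusCoeff w) key
  rwa [map_add, map_add, h₁, h₂, zero_add, zero_add] at this

end Endomorphism

section Twist

variable {Y : Type*}

/-- The copy of the word `w` on the letters of level `j`. -/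
def levelWord (w : FreeGroup Y) (j : ℤ) : FreeGroup (Option (Y × ℤ)) :=
  FreeGroup.map (fun y => some (y, j)) w

/-- The map sending `b = none` to `u * b` and moving every other letter up by `d` levels. -/
def twistHom (u : FreeGroup (Option (Y × ℤ))) (d : ℤ) :
    FreeGroup (Option (Y × ℤ)) →* FreeGroup (Option (Y × ℤ)) :=
  FreeGroup.lift fun x => x.elim (u * FreeGroup.of none) fun p => FreeGroup.of (some (p.1, p.2 + d))

theorem twistHom_none (u : FreeGroup (Option (Y × ℤ))) (d : ℤ) :
    twistHom u d (FreeGroup.of none) = u * FreeGroup.of none := by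
  simp [twistHom]

theorem twistHom_some (u : FreeGroup (Option (Y × ℤ))) (d : ℤ) (y : Y) (l : ℤ) :
    twistHom u d (FreeGroup.of (some (y, l))) = FreeGroup.of (some (y, l + d)) := by
  simp [twistHom]

theorem twistHom_levelWord (u : FreeGroup (Option (Y × ℤ))) (d : ℤ) (w : FreeGroup Y) (j : ℤ) :
    twistHom u d (levelWord w j) = levelWord w (j + d) := by
  have : (twistHom u d).comp (FreeGroup.map fun y => some (y, j)) =
      FreeGroup.map fun y => some (y, j + d) := by
    ext y
    simp [twistHom_some]
  exact DFunLike.congr_fun this w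

/-- The automorphism sending `b = none` to `w₀⁻¹ * b`, where `w₀` is the copy of `w` at level `0`,
and moving every other letter one level up. -/
def twist (w : FreeGroup Y) : MulAut (FreeGroup (Option (Y × ℤ))) :=
  MonoidHom.toMulEquiv (twistHom (levelWord w 0)⁻¹ 1) (twistHom (levelWord w (-1)) (-1))
    (by
      ext (_ | ⟨y, l⟩)
      · simp [twistHom_none, twistHom_levelWord]
      · simp [twistHom_some])
    (by
      ext (_ | ⟨y, l⟩)
      · simp [twistHom_none, twistHom_levelWord]
      · simp [twistHom_some])

theorem twist_none (w : FreeGroup Y) :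
    twist w (FreeGroup.of none) = (levelWord w 0)⁻¹ * FreeGroup.of none := twistHom_none _ _

theorem twist_some (w : FreeGroup Y) (y : Y) (l : ℤ) :
    twist w (FreeGroup.of (some (y, l))) = FreeGroup.of (some (y, l + 1)) :=
  twistHom_some (levelWord w 0)⁻¹ 1 y l

theorem twist_pow_some (w : FreeGroup Y) (K : ℕ) (y : Y) (l : ℤ) :
    (twist w ^ K) (FreeGroup.of (some (y, l))) = FreeGroup.of (some (y, l + K)) := by
  induction K with
  | zero => simp
  | succ K ih => rw [pow_succ', MulAut.mul_apply, ih, twist_some]; push_cast; rw [add_assoc]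

theorem twist_pow_levelWord (w v : FreeGroup Y) (K : ℕ) (j : ℤ) :
    (twist w ^ K) (levelWord v j) = levelWord v (j + K) := by
  have : ((twist w ^ K).toMonoidHom).comp (FreeGroup.map fun y => some (y, j)) =
      FreeGroup.map fun y => some (y, j + K) := by
    ext y
    simp [twist_pow_some]
  exact DFunLike.congr_fun this v

/-- Moving letters other than `none` up by `K` levels. -/
def levelShift (K : ℕ) (x : Option (Y × ℤ)) : Option (Y × ℤ) :=
  x.map fun p => (p.1, p.2 + K)

variable [DecidableEq Y]

theorem expSum_none_levelWord (w : FreeGroup Y) (j : ℤ) : expSum none (levelWord w j) = 1 := by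
  have : (expSum none).comp (FreeGroup.map fun y : Y => some (y, j)) = 1 := by
    ext y
    simp [expSum]
  exact DFunLike.congr_fun this w

theorem expSum_some_levelWord {w : FreeGroup Y} (hw : ∀ y, expSum y w = 1) (j : ℤ) (y : Y) (l : ℤ) :
    expSum (some (y, l)) (levelWord w j) = 1 := by
  by_cases h : j = l
  · have : (expSum (some (y, l))).comp (FreeGroup.map fun y : Y => some (y, j)) = expSum y := by
      ext z
      simp [expSum, h]
    exact (DFunLike.congr_fun this w).trans (hw y)
  · have : (expSum (some (y, l))).comp (FreeGroup.map fun y : Y => some (y, j)) = 1 := by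
      ext z
      simp [expSum, h]
    exact DFunLike.congr_fun this w

theorem expSum_comp_twist {w : FreeGroup Y} (hw : ∀ y, expSum y w = 1) (x : Option (Y × ℤ)) :
    (expSum (levelShift 1 x)).comp (twist w).toMonoidHom = expSum x := by
  rcases x with _ | ⟨y, l⟩
  · ext (_ | ⟨z, m⟩)
    · simp [twist_none, levelShift, expSum_none_levelWord]
    · simp [twist_some, levelShift, expSum]
  · ext (_ | ⟨z, m⟩)
    · simp [twist_none, levelShift, expSum_some_levelWord hw]
      simp [expSum]
    · simp [twist_some, levelShift, expSum]

theorem expSum_comp_twist_pow {w : FreeGroup Y} (hw : ∀ y, expSum y w = 1) (K : ℕ)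
    (x : Option (Y × ℤ)) :
    (expSum (levelShift K x)).comp (twist w ^ K).toMonoidHom = expSum x := by
  induction K with
  | zero =>
    have : levelShift 0 x = x := by rcases x with _ | ⟨y, l⟩ <;> simp [levelShift]
    rw [this]
    rfl
  | succ K ih =>
    have : levelShift (K + 1) x = levelShift 1 (levelShift K x) := by
      rcases x with _ | ⟨y, l⟩ <;> simp [levelShift, add_assoc]
    rw [this, ← ih, ← expSum_comp_twist hw (levelShift K x), pow_succ']
    rfl

/-- The retraction onto the letters of level `j`. -/
def levelProj (j : ℤ) : FreeGroup (Option (Y × ℤ)) →* FreeGroup Y :=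
  FreeGroup.lift fun x => x.elim 1 fun p => if p.2 = j then FreeGroup.of p.1 else 1

omit [DecidableEq Y] in
theorem levelProj_levelWord (w : FreeGroup Y) (i j : ℤ) :
    levelProj j (levelWord w i) = if i = j then w else 1 := by
  have : (levelProj j).comp (FreeGroup.map fun y : Y => some (y, i)) =
      if i = j then MonoidHom.id _ else 1 := by
    ext y
    split_ifs with h <;> simp [levelProj, h]
  refine (DFunLike.congr_fun this w).trans ?_
  split_ifs <;> rfl

omit [DecidableEq Y] in
theorem exists_levelProj_eq_one (g : FreeGroup (Option (Y × ℤ))) :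
    ∃ N : ℕ, ∀ j : ℕ, N < j → levelProj j g = 1 := by
  induction g using FreeGroup.induction_on with
  | C1 => simp
  | of x =>
    rcases x with _ | ⟨y, l⟩
    · simp [levelProj]
    · refine ⟨l.natAbs, fun j hj => ?_⟩
      have : l ≠ j := by omega
      simp [levelProj, this]
  | inv_of x ih => simpa using ih
  | mul g h ihg ihh =>
    obtain ⟨N, hN⟩ := ihg
    obtain ⟨M, hM⟩ := ihh
    refine ⟨max N M, fun j hj => ?_⟩
    rw [map_mul, hN j (by omega), hM j (by omega), mul_one]

omit [DecidableEq Y] in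
theorem levelProj_twist_pow_none (w : FreeGroup Y) (j K : ℕ) :
    levelProj j ((twist w ^ K) (FreeGroup.of none)) = if j < K then w⁻¹ else 1 := by
  induction K with
  | zero => simp [levelProj]
  | succ K ih =>
    rw [pow_succ, MulAut.mul_apply, twist_none, map_mul, map_mul, ih, map_inv, map_inv,
      twist_pow_levelWord, levelProj_levelWord]
    rcases lt_trichotomy j K with h | rfl | h
    · have h₁ : (K : ℤ) ≠ j := by omega
      simp [h, h₁, h.trans (Nat.lt_succ_self K)]
    · simp
    · have h₁ : (K : ℤ) ≠ j := by omega
      have h₂ : ¬ j < K + 1 := by omega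
      simp [h₁, h₂, h.not_gt]

theorem exists_levelProj_twist_pow (w : FreeGroup Y) (g : FreeGroup (Option (Y × ℤ))) :
    ∃ N : ℕ, ∀ j K : ℕ, N < j → j + N < K →
      levelProj j ((twist w ^ K) g) = w ^ (-(expSum none g).toAdd) := by
  induction g using FreeGroup.induction_on with
  | C1 => simp
  | of x =>
    rcases x with _ | ⟨y, l⟩
    · refine ⟨0, fun j K _ h => ?_⟩
      rw [levelProj_twist_pow_none, if_pos (by omega), expSum_of]
      simp
    · refine ⟨l.natAbs, fun j K hj h => ?_⟩
      have : l + K ≠ j := by omega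
      rw [twist_pow_some, expSum_of]
      simp [levelProj, this]
  | inv_of x ih =>
    obtain ⟨N, hN⟩ := ih
    refine ⟨N, fun j K hj h => ?_⟩
    rw [map_inv, map_inv, hN j K hj h]
    simp
  | mul g h ihg ihh =>
    obtain ⟨N, hN⟩ := ihg
    obtain ⟨M, hM⟩ := ihh
    refine ⟨max N M, fun j K hj h => ?_⟩
    rw [map_mul, map_mul, hN j K (by omega) (by omega), hM j K (by omega) (by omega), ← zpow_add,
      map_mul, toAdd_mul]
    congr 1
    ring

/-- The endomorphism killing all letters except `none`. -/
def noneProj : FreeGroup (Option (Y × ℤ)) →* FreeGroup (Option (Y × ℤ)) :=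
  FreeGroup.lift fun x => x.elim (FreeGroup.of none) fun _ => 1

theorem noneProj_eq (g : FreeGroup (Option (Y × ℤ))) :
    noneProj g = FreeGroup.of none ^ (expSum none g).toAdd := by
  have : noneProj (Y := Y) = (zpowersHom _ (FreeGroup.of none)).comp (expSum none) := by
    ext (_ | p) <;> simp [noneProj, expSum]
  rw [this]
  rfl

theorem eq_one_of_twist_pow_conj [Nonempty Y] {w : FreeGroup Y} (hw1 : w ≠ 1)
    (hw : ∀ y, expSum y w = 1) (g : FreeGroup (Option (Y × ℤ)))
    (H : ∀ N : ℕ, ∃ K : ℕ, N ≤ K ∧ ∃ f, f * (twist w ^ K) g = g * f) : g = 1 := by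
  by_contra hg
  obtain ⟨k, hk, ha, c, hc0, hck, hc⟩ := exists_leading_magnusCoeff hg
  have hnone : ∀ v ∈ c.support, ∀ x ∈ v, x = none := by
    have hfin : {l : ℤ | ∃ v ∈ c.support, ∃ y : Y, some (y, l) ∈ v}.Finite := by
      have : (⋃ v ∈ c.support, {x | x ∈ v}).Finite :=
        c.support.finite_toSet.biUnion fun v _ => v.finite_toSet
      refine (this.image fun x => x.elim 0 Prod.snd).subset ?_
      rintro l ⟨v, hv, y, hy⟩
      exact ⟨some (y, l), by simpa using ⟨v, by simpa using hv, hy⟩, rfl⟩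
    obtain ⟨u, hu⟩ := hfin.bddAbove
    rintro v hv (_ | ⟨y, l⟩) hx
    · rfl
    obtain ⟨K, hK, f, hf⟩ := H (u - l + 1).toNat
    have hlen : (v.map (levelShift K)).length = v.length := List.length_map _
    have hvk := hck v hv
    have hcoeff : c (v.map (levelShift K)) = c v := by
      rw [← hc v hvk, ← hc _ (hlen.trans hvk),
        ← magnusCoeff_ringMap_of_conj (twist w ^ K).toMonoidHom hf _ (by rwa [hlen, hvk])]
      refine magnusCoeff_ringMap _ ?_ (by rwa [hvk])
      rw [List.forall₂_map_right_iff, List.forall₂_same]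
      exact fun x _ => expSum_comp_twist_pow hw K x
    have hmem : v.map (levelShift K) ∈ c.support := by
      rw [Finsupp.mem_support_iff, hcoeff]
      exact Finsupp.mem_support_iff.1 hv
    have := hu ⟨_, hmem, y, List.mem_map.2 ⟨_, hx, rfl⟩⟩
    omega
  have he : (expSum none g).toAdd ≠ 0 := by
    intro he
    obtain ⟨v, hv⟩ := Finsupp.support_nonempty_iff.2 hc0
    have h := magnusCoeff_ringMap (w := v) (w' := v) noneProj ?_ (hck v hv ▸ ha)
    · rw [map_sub, map_one, ringMap_of, noneProj_eq, he, zpow_zero, map_one, sub_self, map_zero,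
        hc v (hck v hv)] at h
      exact Finsupp.mem_support_iff.1 hv h.symm
    · rw [List.forall₂_same]
      intro x hx
      rw [hnone v hv x hx]
      ext (_ | p) <;> simp [noneProj, expSum]
  obtain ⟨N, hN⟩ := exists_levelProj_eq_one g
  obtain ⟨M, hM⟩ := exists_levelProj_twist_pow w g
  set j := max N M + 1
  obtain ⟨K, hK, f, hf⟩ := H (j + M + 1)
  have := congrArg (levelProj (j : ℤ)) hf
  rw [map_mul, map_mul, hN j (by omega), hM j K (by omega) (by omega), one_mul, mul_eq_left,
    IsMulTorsionFree.zpow_eq_one_iff_right hw1, neg_eq_zero] at this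
  exact he this

end Twist

section MappingTorus

variable {Y : Type*}

/-- The mapping torus of the automorphism `twist w`. -/
abbrev TwistTorus (w : FreeGroup Y) : Type _ :=
  FreeGroup (Option (Y × ℤ)) ⋊[zpowersHom _ (twist w)] Multiplicative ℤ

variable [DecidableEq Y] [Nonempty Y]

theorem TwistTorus.right_eq_one_of_commute {w : FreeGroup Y} (hw1 : w ≠ 1)
    (hw : ∀ y, expSum y w = 1) {g : FreeGroup (Option (Y × ℤ))} (hg : g ≠ 1) {h : TwistTorus w}
    (hc : Commute h (SemidirectProduct.inl g)) : h.right = 1 := by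
  by_contra hn
  refine hg (eq_one_of_twist_pow_conj hw1 hw g fun N => ?_)
  set n : ℤ := h.right.toAdd with hndef
  have hn0 : n ≠ 0 := fun h0 => hn (Multiplicative.toAdd.injective h0)
  refine ⟨n.natAbs * N, Nat.le_mul_of_pos_left _ (Int.natAbs_pos.2 hn0), (h ^ (n.sign * N)).left, ?_⟩
  have hright : (h ^ (n.sign * N)).right = Multiplicative.ofAdd ((n.natAbs * N : ℕ) : ℤ) := by
    have : (h ^ (n.sign * N)).right = h.right ^ (n.sign * N) :=
      map_zpow SemidirectProduct.rightHom h _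
    rw [this]
    apply Multiplicative.toAdd.injective
    rw [toAdd_zpow, toAdd_ofAdd, ← hndef, Nat.cast_mul, ← Int.sign_mul_self_eq_natAbs, smul_eq_mul]
    ring
  have := congrArg SemidirectProduct.left (hc.zpow_left (n.sign * N)).eq
  rw [SemidirectProduct.mul_left, SemidirectProduct.mul_left, hright, zpowersHom_apply,
    toAdd_ofAdd, zpow_natCast] at this
  simpa using this

theorem TwistTorus.isCyclic_centralizer {w : FreeGroup Y} (hw1 : w ≠ 1)
    (hw : ∀ y, expSum y w = 1) {h : TwistTorus w} (hh : h ≠ 1) :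
    IsCyclic (Subgroup.centralizer {h}) := by
  have hcomm (x : Subgroup.centralizer {h}) : Commute x.1 h :=
    Subgroup.mem_centralizer_singleton_iff.1 x.2
  by_cases hr : h.right = 1
  · obtain ⟨g, rfl⟩ : ∃ g, SemidirectProduct.inl g = h :=
      ⟨h.left, SemidirectProduct.ext rfl hr.symm⟩
    have hg : g ≠ 1 := by
      rintro rfl
      exact hh (map_one _)
    have hright (x : Subgroup.centralizer {(SemidirectProduct.inl g : TwistTorus w)}) :
        x.1.right = 1 := TwistTorus.right_eq_one_of_commute hw1 hw hg (hcomm x)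
    have := FreeGroup.isCyclic_centralizer hg
    let φ : Subgroup.centralizer {(SemidirectProduct.inl g : TwistTorus w)} →*
        Subgroup.centralizer {g} :=
      MonoidHom.mk' (fun x => ⟨x.1.left, by
        rw [Subgroup.mem_centralizer_singleton_iff]
        have := congrArg SemidirectProduct.left (hcomm x).eq
        rw [SemidirectProduct.mul_left, hright x] at this
        simpa using this⟩) fun x y => by
          ext1
          simp [hright x]
    refine isCyclic_of_injective φ fun x y hxy => ?_
    ext1
    exact SemidirectProduct.ext (congrArg Subtype.val hxy) ((hright x).trans (hright y).symm)
  · refine isCyclic_of_injective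
      (SemidirectProduct.rightHom.comp (Subgroup.centralizer {h}).subtype)
      ((injective_iff_map_eq_one _).2 fun x hx => ?_)
    obtain ⟨c, hcx⟩ : ∃ c, SemidirectProduct.inl c = x.1 :=
      ⟨x.1.left, SemidirectProduct.ext rfl (Eq.symm hx)⟩
    by_contra hx1
    refine hr (TwistTorus.right_eq_one_of_commute hw1 hw (g := c) ?_ (hcx ▸ (hcomm x).symm))
    rintro rfl
    exact hx1 (Subtype.ext (hcx.symm.trans (map_one _)))

end MappingTorus

theorem surfaceRelator_succ (n : ℕ) :
    surfaceRelator (n + 1) =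
      FreeGroup.of (0, false) * FreeGroup.of (0, true) * (FreeGroup.of (0, false))⁻¹ *
        (FreeGroup.of (0, true))⁻¹ *
        FreeGroup.map (fun p : Fin n × Bool => (p.1.succ, p.2)) (surfaceRelator n) := by
  rw [surfaceRelator, List.ofFn_succ, List.prod_cons, surfaceRelator, map_list_prod, List.map_ofFn]
  congr 3

theorem map_surfaceRelator_eq_one {A : Type*} [CommGroup A] (n : ℕ)
    (f : FreeGroup (Fin n × Bool) →* A) : f (surfaceRelator n) = 1 := by
  rw [surfaceRelator, map_list_prod, List.map_ofFn]
  refine List.prod_eq_one fun x hx => ?_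
  obtain ⟨i, rfl⟩ := (List.mem_ofFn' _ _).1 hx
  simp

theorem surfaceRelator_ne_one (n : ℕ) : surfaceRelator (n + 1) ≠ 1 := by
  intro h
  let f : FreeGroup (Fin (n + 1) × Bool) →* Equiv.Perm (Fin 3) :=
    FreeGroup.lift fun p => if p.1 = 0 then (if p.2 then Equiv.swap 0 1 else Equiv.swap 1 2) else 1
  have h₁ := congrArg f h
  have h₂ : f.comp (FreeGroup.map fun p : Fin n × Bool => (p.1.succ, p.2)) = 1 := by
    ext1 p
    simp [f]
  have h₃ := DFunLike.congr_fun h₂ (surfaceRelator n)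
  rw [MonoidHom.comp_apply] at h₃
  rw [surfaceRelator_succ, map_mul, h₃] at h₁
  simp only [map_mul, map_inv, map_one, f, FreeGroup.lift_apply_of, MonoidHom.one_apply,
    if_true, Bool.false_eq_true, if_false] at h₁
  revert h₁
  decide

namespace SurfaceGroup

variable (n : ℕ)

/-- The images of the generators in the mapping torus. -/
def torusGen : Fin (n + 1) × Bool → TwistTorus (surfaceRelator n)
  | (i, b) => Fin.cases
      (bif b then SemidirectProduct.inl (FreeGroup.of none)
        else SemidirectProduct.inr (Multiplicative.ofAdd 1))
      (fun i => SemidirectProduct.inl (FreeGroup.of (some ((i, b), 0)))) i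

theorem lift_torusGen_surfaceRelator :
    FreeGroup.lift (torusGen n) (surfaceRelator (n + 1)) = 1 := by
  have h : (FreeGroup.lift (torusGen n)).comp
      (FreeGroup.map fun p : Fin n × Bool => (p.1.succ, p.2)) =
      SemidirectProduct.inl.comp (FreeGroup.map fun p => some (p, 0)) := by
    ext1 p
    simp [torusGen]
  have h' := DFunLike.congr_fun h (surfaceRelator n)
  rw [MonoidHom.comp_apply] at h'
  rw [surfaceRelator_succ, map_mul, h']
  have := SemidirectProduct.inl_aut (φ := zpowersHom _ (twist (surfaceRelator n)))
    (Multiplicative.ofAdd 1) (FreeGroup.of none)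
  simp only [map_mul, map_inv, FreeGroup.lift_apply_of]
  change SemidirectProduct.inr _ * SemidirectProduct.inl _ * (SemidirectProduct.inr _)⁻¹ *
    (SemidirectProduct.inl _)⁻¹ * SemidirectProduct.inl (levelWord _ 0) = 1
  rw [← map_inv, ← this]
  simp only [zpowersHom_apply, toAdd_ofAdd, zpow_one, twist_none]
  simp

/-- The homomorphism from a surface group to a mapping torus. -/
def toTorus : SurfaceGroup (n + 1) →* TwistTorus (surfaceRelator n) :=
  PresentedGroup.toGroup (f := torusGen n) (by
    rintro _ rfl
    exact lift_torusGen_surfaceRelator n)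

/-- The generators of a surface group. -/
abbrev gen (i : Fin (n + 1)) (b : Bool) : SurfaceGroup (n + 1) := PresentedGroup.of (i, b)

/-- The images in the surface group of the letters of the fibre of the mapping torus. -/
def fibreHom : FreeGroup (Option ((Fin n × Bool) × ℤ)) →* SurfaceGroup (n + 1) :=
  FreeGroup.lift fun x => x.elim (gen n 0 true) fun p =>
    MulAut.conj (gen n 0 false ^ p.2) (gen n p.1.1.succ p.1.2)

theorem fibreHom_twist (x : FreeGroup (Option ((Fin n × Bool) × ℤ))) :
    fibreHom n (twist (surfaceRelator n) x) = MulAut.conj (gen n 0 false) (fibreHom n x) := by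
  suffices h : (fibreHom n).comp (twist (surfaceRelator n)).toMonoidHom =
      (MulAut.conj (gen n 0 false)).toMonoidHom.comp (fibreHom n) from DFunLike.congr_fun h x
  have hrel : PresentedGroup.mk {surfaceRelator (n + 1)} (surfaceRelator (n + 1)) = 1 :=
    PresentedGroup.one_of_mem rfl
  have hlevel : (fibreHom n).comp (FreeGroup.map fun p => some (p, 0)) =
      (PresentedGroup.mk {surfaceRelator (n + 1)}).comp
        (FreeGroup.map fun p : Fin n × Bool => (p.1.succ, p.2)) := by
    ext1 p
    simp [fibreHom]
    rfl
  have hlevel' := DFunLike.congr_fun hlevel (surfaceRelator n)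
  rw [MonoidHom.comp_apply, MonoidHom.comp_apply] at hlevel'
  have hword := congrArg (PresentedGroup.mk {surfaceRelator (n + 1)}) (surfaceRelator_succ n)
  rw [hrel, map_mul, ← hlevel', eq_comm] at hword
  ext1 (_ | ⟨⟨i, b⟩, l⟩)
  · simp only [MonoidHom.comp_apply, MulEquiv.toMonoidHom_eq_coe, MonoidHom.coe_coe, twist_none,
      map_mul, map_inv]
    have : fibreHom n (FreeGroup.of none) = gen n 0 true := by simp [fibreHom]
    rw [this, MulAut.conj_apply, inv_mul_eq_iff_eq_mul, levelWord,
      eq_inv_of_mul_eq_one_right hword]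
    simp only [map_mul, map_inv]
    change _ = (gen n 0 false * gen n 0 true * (gen n 0 false)⁻¹ * (gen n 0 true)⁻¹)⁻¹ * _
    group
  · simp only [MonoidHom.comp_apply, MulEquiv.toMonoidHom_eq_coe, MonoidHom.coe_coe, twist_some,
      fibreHom, FreeGroup.lift_apply_of, Option.elim_some, add_comm l, zpow_one_add, map_mul,
      MulAut.mul_apply]

theorem fibreHom_twist_zpow (k : ℤ) (x : FreeGroup (Option ((Fin n × Bool) × ℤ))) :
    fibreHom n ((twist (surfaceRelator n) ^ k) x) =
      MulAut.conj (gen n 0 false ^ k) (fibreHom n x) := by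
  rw [map_zpow MulAut.conj]
  induction k using Int.induction_on generalizing x with
  | zero => simp
  | succ k ih =>
    rw [zpow_add_one, zpow_add_one, MulAut.mul_apply, ih, fibreHom_twist, MulAut.mul_apply]
  | pred k ih =>
    rw [zpow_sub_one, zpow_sub_one, MulAut.mul_apply, ih, MulAut.mul_apply]
    rw [← MulAut.apply_inv_self _ (twist (surfaceRelator n)) x, fibreHom_twist,
      MulAut.inv_apply_self, MulAut.inv_apply_self]

/-- The inverse homomorphism from the mapping torus to the surface group. -/
def ofTorus : TwistTorus (surfaceRelator n) →* SurfaceGroup (n + 1) :=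
  SemidirectProduct.lift (fibreHom n) (zpowersHom _ (gen n 0 false)) fun z => by
    ext1 x
    exact fibreHom_twist_zpow n z.toAdd (FreeGroup.of x)

theorem toTorus_injective : Function.Injective (toTorus n) := by
  have h : (ofTorus n).comp (toTorus n) = MonoidHom.id _ := by
    refine PresentedGroup.ext ?_
    rintro ⟨i, b⟩
    rw [MonoidHom.comp_apply, toTorus, PresentedGroup.toGroup.of, MonoidHom.id_apply]
    cases i using Fin.cases with
    | zero => cases b <;> simp [torusGen, ofTorus, fibreHom]
    | succ i => simp [torusGen, ofTorus, fibreHom]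
  exact Function.LeftInverse.injective (g := ofTorus n) fun x => DFunLike.congr_fun h x

end SurfaceGroup

/-- For `g ≥ 2`, the centralizer of any nontrivial element `γ` of the genus-`g` surface
group is cyclic: there is `z` such that every element commuting with `γ` is an integer
power of `z`. -/
theorem surfaceGroup_centralizer_cyclic (g : ℕ) (hg : 2 ≤ g)
    (γ : SurfaceGroup g) (hγ : γ ≠ 1) :
    ∃ z : SurfaceGroup g, ∀ x : SurfaceGroup g, x * γ = γ * x → ∃ n : ℤ, x = z ^ n := by
  obtain ⟨n, rfl⟩ : ∃ n, g = n + 1 + 1 := ⟨g - 2, by omega⟩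
  set ι := SurfaceGroup.toTorus (n + 1)
  have hι : Function.Injective ι := SurfaceGroup.toTorus_injective (n + 1)
  have hcyc : IsCyclic (Subgroup.centralizer {ι γ}) :=
    TwistTorus.isCyclic_centralizer (surfaceRelator_ne_one n)
      (fun y => map_surfaceRelator_eq_one _ _) (by rwa [Ne, map_eq_one_iff ι hι])
  let φ : Subgroup.centralizer {γ} →* Subgroup.centralizer {ι γ} :=
    (ι.comp (Subgroup.centralizer {γ}).subtype).codRestrict _ fun x => by
      rw [Subgroup.mem_centralizer_singleton_iff, MonoidHom.comp_apply, ← map_mul, ← map_mul]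
      exact congrArg ι (Subgroup.mem_centralizer_singleton_iff.1 x.2)
  have hφ : Function.Injective φ := fun x y hxy =>
    Subtype.ext (hι (congrArg Subtype.val hxy))
  obtain ⟨z, hz⟩ := isCyclic_of_injective φ hφ
  refine ⟨z, fun x hx => ?_⟩
  obtain ⟨k, hk⟩ := hz ⟨x, Subgroup.mem_centralizer_singleton_iff.2 hx⟩
  exact ⟨k, (congrArg Subtype.val hk).symm⟩
end

section
/- For every g ≥ 2 and every nontrivial element γ of the genus-g surface group π₁(S_g), there exist an element δ ∈ π₁(S_g) and an integer n ≥ 1 such that γ = δ^n and δ is not a proper power, i.e., there is no ε ∈ π₁(S_g) and integer m ≥ 2 with δ = ε^m. -/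
open FreeGroup.reduceCyclically in
/-- In a free group, the exponent of a root of a nontrivial element is at most its word length. -/
theorem FreeGroup.le_norm_pow {α : Type*} [DecidableEq α] (y : FreeGroup α) (n : ℕ)
    (h : y ^ n ≠ 1) : n ≤ (y ^ n).norm := by
  have hn : n ≠ 0 := by rintro rfl; simp at h
  have hred : FreeGroup.reduceCyclically y.toWord ≠ [] := by
    intro h0
    have hy := FreeGroup.reduceCyclically.conj_conjugator_reduceCyclically y.toWord
    rw [h0] at hy
    apply h
    have : y = 1 := by
      rw [← FreeGroup.mk_toWord (x := y), ← hy, List.append_nil, ← FreeGroup.mul_mk,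
        ← FreeGroup.inv_mk, mul_inv_cancel]
    rw [this, one_pow]
  have hpos := List.length_pos_iff.mpr hred
  have hw : (y ^ n).norm = (conjugator y.toWord).length +
      (n * (FreeGroup.reduceCyclically y.toWord).length + (conjugator y.toWord).length) := by
    simp [FreeGroup.norm, FreeGroup.toWord_pow, reduce_flatten_replicate,
      FreeGroup.isReduced_toWord, hn]
  rw [hw]
  nlinarith

/-- Exponents of roots of a nontrivial element of a free-by-cyclic group are bounded. -/
theorem SemidirectProduct.exists_exponent_bound {α : Type*}
    {φ : Multiplicative ℤ →* MulAut (FreeGroup α)}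
    (x : FreeGroup α ⋊[φ] Multiplicative ℤ) (hx : x ≠ 1) :
    ∃ N : ℕ, ∀ (y : FreeGroup α ⋊[φ] Multiplicative ℤ) (n : ℕ), x = y ^ n → n ≤ N := by
  classical
  by_cases hr : x.right = 1
  · refine ⟨x.left.norm, fun y n hxy => ?_⟩
    have hn : n ≠ 0 := by rintro rfl; exact hx (by simpa using hxy)
    have hyr : y.right = 1 := by
      have h1 : y.right ^ n = 1 := by
        rw [← hr, hxy]
        exact (map_pow SemidirectProduct.rightHom y n).symm
      exact (pow_eq_one_iff_left hn).mp h1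
    have hy : y = SemidirectProduct.inl y.left := by ext <;> simp [hyr]
    have hxl : x.left = y.left ^ n := by
      rw [hxy, hy, ← map_pow, SemidirectProduct.left_inl, SemidirectProduct.left_inl]
    rw [hxl]
    apply FreeGroup.le_norm_pow
    rw [← hxl]
    intro hl
    exact hx (SemidirectProduct.ext hl hr)
  · refine ⟨x.right.toAdd.natAbs, fun y n hxy => ?_⟩
    have h1 : x.right = y.right ^ n := by
      rw [hxy]
      exact map_pow SemidirectProduct.rightHom y n
    have h2 : x.right.toAdd = n * y.right.toAdd := by rw [h1]; simp
    have h3 : x.right.toAdd ≠ 0 := hr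
    rw [h2] at h3 ⊢
    rw [Int.natAbs_mul, Int.natAbs_natCast]
    exact Nat.le_mul_of_pos_right n (Int.natAbs_pos.mpr (right_ne_zero_of_mul h3))

/-- An element whose roots have bounded exponents is a power of an element which is not a
proper power. -/
theorem exists_primitive_root_of_exponent_bound {G : Type*} [Group G] (γ : G) (N : ℕ)
    (hN : ∀ (δ : G) (n : ℕ), γ = δ ^ n → n ≤ N) :
    ∃ (δ : G) (n : ℕ), 1 ≤ n ∧ γ = δ ^ n ∧ ¬ ∃ (ε : G) (m : ℕ), 2 ≤ m ∧ δ = ε ^ m := by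
  classical
  have h1 : ∃ δ : G, γ = δ ^ 1 := ⟨γ, (pow_one γ).symm⟩
  have hle : 1 ≤ N := hN γ 1 (pow_one γ).symm
  set n := Nat.findGreatest (fun n => ∃ δ : G, γ = δ ^ n) N with hn
  have hn1 : 1 ≤ n := Nat.le_findGreatest hle h1
  obtain ⟨δ, hδ⟩ : ∃ δ : G, γ = δ ^ n :=
    Nat.findGreatest_spec (P := fun n => ∃ δ : G, γ = δ ^ n) hle h1
  refine ⟨δ, n, hn1, hδ, ?_⟩
  rintro ⟨ε, m, hm, rfl⟩
  rw [← pow_mul] at hδ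
  have : m * n ≤ n := Nat.le_findGreatest (hN ε _ hδ) ⟨ε, hδ⟩
  nlinarith

/-- The product of commutators `[f(0,false), f(0,true)] ⋯ [f(h-1,false), f(h-1,true)]`. -/
def commutatorProd {G : Type*} [Group G] {h : ℕ} (f : Fin h × Bool → G) : G :=
  (List.ofFn fun i => f (i, false) * f (i, true) * (f (i, false))⁻¹ * (f (i, true))⁻¹).prod

theorem map_commutatorProd {G H : Type*} [Group G] [Group H] {h : ℕ} (F : G →* H)
    (f : Fin h × Bool → G) : F (commutatorProd f) = commutatorProd (fun x => F (f x)) := by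
  simp [commutatorProd, map_list_prod, List.map_ofFn, Function.comp_def]

theorem commutatorProd_succ {G : Type*} [Group G] {h : ℕ} (f : Fin (h + 1) × Bool → G) :
    commutatorProd f = f (0, false) * f (0, true) * (f (0, false))⁻¹ * (f (0, true))⁻¹ *
      commutatorProd (fun x : Fin h × Bool => f (x.1.succ, x.2)) := by
  simp [commutatorProd, List.ofFn_succ]

theorem surfaceRelator_eq_commutatorProd (g : ℕ) :
    surfaceRelator g = commutatorProd FreeGroup.of := rfl

/-- The fundamental group of the infinite cyclic cover of the surface of genus `h + 1` dual to
the generator `a₁`; `none` stands for `b₁` and `some (k, x)` for the conjugate of the generator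
`x` of the other handles by `a₁ ^ k`. -/
abbrev CyclicCoverGroup (h : ℕ) : Type := FreeGroup (Option (ℤ × Fin h × Bool))

namespace CyclicCoverGroup

variable {h : ℕ}

/-- The boundary word of the `k`-th lift of the last `h` handles. -/
def boundary (h : ℕ) (k : ℤ) : CyclicCoverGroup h :=
  commutatorProd fun x => FreeGroup.of (some (k, x))

/-- The endomorphism induced by the generating deck transformation. -/
def shiftHom (h : ℕ) : CyclicCoverGroup h →* CyclicCoverGroup h :=
  FreeGroup.lift fun o => o.elim ((boundary h 0)⁻¹ * FreeGroup.of none)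
    fun p => FreeGroup.of (some (p.1 + 1, p.2))

/-- The endomorphism induced by the inverse of the generating deck transformation. -/
def unshiftHom (h : ℕ) : CyclicCoverGroup h →* CyclicCoverGroup h :=
  FreeGroup.lift fun o => o.elim (boundary h (-1) * FreeGroup.of none)
    fun p => FreeGroup.of (some (p.1 - 1, p.2))

@[simp]
theorem shiftHom_none : shiftHom h (FreeGroup.of none) =
    (boundary h 0)⁻¹ * FreeGroup.of none := by
  simp [shiftHom]

@[simp]
theorem shiftHom_some (p : ℤ × Fin h × Bool) : shiftHom h (FreeGroup.of (some p)) =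
    FreeGroup.of (some (p.1 + 1, p.2)) := by
  simp [shiftHom]

@[simp]
theorem unshiftHom_none : unshiftHom h (FreeGroup.of none) =
    boundary h (-1) * FreeGroup.of none := by
  simp [unshiftHom]

@[simp]
theorem unshiftHom_some (p : ℤ × Fin h × Bool) : unshiftHom h (FreeGroup.of (some p)) =
    FreeGroup.of (some (p.1 - 1, p.2)) := by
  simp [unshiftHom]

@[simp]
theorem shiftHom_boundary (k : ℤ) : shiftHom h (boundary h k) = boundary h (k + 1) := by
  simp [boundary, map_commutatorProd]

@[simp]
theorem unshiftHom_boundary (k : ℤ) : unshiftHom h (boundary h k) = boundary h (k - 1) := by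
  simp [boundary, map_commutatorProd]

/-- The automorphism induced by the generating deck transformation. -/
def shift (h : ℕ) : MulAut (CyclicCoverGroup h) :=
  MonoidHom.toMulEquiv (shiftHom h) (unshiftHom h)
    (by ext (_ | p) <;> simp)
    (by ext (_ | p) <;> simp)

@[simp]
theorem shift_apply (x : CyclicCoverGroup h) : shift h x = shiftHom h x := rfl

/-- The action of `ℤ` by deck transformations. -/
def deck (h : ℕ) : Multiplicative ℤ →* MulAut (CyclicCoverGroup h) :=
  zpowersHom _ (shift h)

@[simp]
theorem deck_ofAdd_one : deck h (Multiplicative.ofAdd 1) = shift h := by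
  simp [deck]

end CyclicCoverGroup

namespace SurfaceGroup

open CyclicCoverGroup

variable {h : ℕ}

/-- The images of the standard generators in the free-by-cyclic group. -/
def toSemidirectGen (h : ℕ) (x : Fin (h + 1) × Bool) :
    CyclicCoverGroup h ⋊[deck h] Multiplicative ℤ :=
  Fin.cases (if x.2 then SemidirectProduct.inl (FreeGroup.of none)
      else SemidirectProduct.inr (Multiplicative.ofAdd 1))
    (fun i => SemidirectProduct.inl (FreeGroup.of (some (0, i, x.2)))) x.1

/-- The decomposition of the surface group as a free-by-cyclic group. -/
def toSemidirect (h : ℕ) :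
    SurfaceGroup (h + 1) →* CyclicCoverGroup h ⋊[deck h] Multiplicative ℤ :=
  PresentedGroup.toGroup (f := toSemidirectGen h) (by
    rintro r rfl
    rw [surfaceRelator_eq_commutatorProd, map_commutatorProd, commutatorProd_succ]
    simp only [FreeGroup.lift_apply_of, toSemidirectGen, Fin.cases_zero, Fin.cases_succ]
    rw [← map_commutatorProd]
    have := SemidirectProduct.inl_aut (φ := deck h) (Multiplicative.ofAdd 1)
      (FreeGroup.of none)
    rw [deck_ofAdd_one, shift_apply, shiftHom_none, map_inv] at this
    simp only [if_true, Bool.false_eq_true, if_false, ← this]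
    simp [boundary])

theorem relation (h : ℕ) :
    (PresentedGroup.of (0, false) * PresentedGroup.of (0, true) *
      (PresentedGroup.of (0, false))⁻¹ : SurfaceGroup (h + 1)) =
    (commutatorProd fun x : Fin h × Bool => PresentedGroup.of (x.1.succ, x.2))⁻¹ *
      PresentedGroup.of (0, true) := by
  have hr : PresentedGroup.mk {surfaceRelator (h + 1)} (commutatorProd FreeGroup.of) = 1 :=
    PresentedGroup.one_of_mem rfl
  rw [map_commutatorProd, commutatorProd_succ, mul_eq_one_iff_eq_inv] at hr
  exact mul_inv_eq_iff_eq_mul.mp hr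

/-- The map from the cyclic cover group to the surface group. -/
def ofCover (h : ℕ) : CyclicCoverGroup h →* SurfaceGroup (h + 1) :=
  FreeGroup.lift fun o => o.elim (PresentedGroup.of (0, true))
    fun p => MulAut.conj (PresentedGroup.of (0, false) ^ p.1)
      (PresentedGroup.of (p.2.1.succ, p.2.2))

theorem ofCover_shift (x : CyclicCoverGroup h) :
    ofCover h (shift h x) = MulAut.conj (PresentedGroup.of (0, false)) (ofCover h x) := by
  have : (ofCover h).comp (shiftHom h) =
      (MulAut.conj (PresentedGroup.of (0, false))).toMonoidHom.comp (ofCover h) := by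
    ext (_ | p)
    · simp [boundary, map_commutatorProd, ofCover, relation]
    · simp [ofCover, zpow_add, mul_assoc, add_comm p.1 1]
  exact DFunLike.congr_fun this x

theorem ofCover_deck (n : Multiplicative ℤ) (x : CyclicCoverGroup h) :
    ofCover h (deck h n x) =
      MulAut.conj (PresentedGroup.of (0, false) ^ n.toAdd) (ofCover h x) := by
  change ofCover h ((shift h ^ n.toAdd) x) = _
  induction n.toAdd using Int.induction_on generalizing x with
  | zero => simp
  | succ k ih =>
    rw [zpow_add_one, MulAut.mul_apply, ih, ofCover_shift, zpow_add_one, map_mul,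
      MulAut.mul_apply]
  | pred k ih =>
    obtain ⟨y, rfl⟩ := (shift h).surjective x
    rw [← MulAut.mul_apply, ← zpow_add_one, sub_add_cancel, ih, ofCover_shift,
      ← MulAut.mul_apply, ← map_mul, ← zpow_add_one, sub_add_cancel]

/-- The inverse of `toSemidirect`. -/
def ofSemidirect (h : ℕ) :
    CyclicCoverGroup h ⋊[deck h] Multiplicative ℤ →* SurfaceGroup (h + 1) :=
  SemidirectProduct.lift (ofCover h) (zpowersHom _ (PresentedGroup.of (0, false)))
    fun n => MonoidHom.ext fun x => ofCover_deck n x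

theorem ofSemidirect_comp_toSemidirect (h : ℕ) :
    (ofSemidirect h).comp (toSemidirect h) = MonoidHom.id _ := by
  refine PresentedGroup.ext ?_
  rintro ⟨i, s⟩
  induction i using Fin.cases <;> cases s <;>
    simp [toSemidirect, toSemidirectGen, ofSemidirect, ofCover]

theorem toSemidirect_injective (h : ℕ) : Function.Injective (toSemidirect h) :=
  Function.LeftInverse.injective (g := ofSemidirect h)
    (DFunLike.congr_fun (ofSemidirect_comp_toSemidirect h))

end SurfaceGroup

/-- For `g ≥ 2`, every nontrivial element `γ` of the genus-`g` surface group has a root which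
is not a proper power: there are `δ` and `n ≥ 1` with `γ = δ ^ n` such that `δ ≠ ε ^ m` for
every `ε` and every `m ≥ 2`. -/
theorem surfaceGroup_exists_primitive_root (g : ℕ) (hg : 2 ≤ g)
    (γ : SurfaceGroup g) (hγ : γ ≠ 1) :
    ∃ (δ : SurfaceGroup g) (n : ℕ), 1 ≤ n ∧ γ = δ ^ n ∧
      ¬ ∃ (ε : SurfaceGroup g) (m : ℕ), 2 ≤ m ∧ δ = ε ^ m := by
  obtain ⟨h, rfl⟩ : ∃ h, g = h + 1 := ⟨g - 1, by omega⟩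
  have hinj := SurfaceGroup.toSemidirect_injective h
  obtain ⟨N, hN⟩ := SemidirectProduct.exists_exponent_bound (SurfaceGroup.toSemidirect h γ)
    ((map_ne_one_iff _ hinj).mpr hγ)
  exact exists_primitive_root_of_exponent_bound γ N fun δ n hδ =>
    hN (SurfaceGroup.toSemidirect h δ) n (by rw [hδ, map_pow])
end
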